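/- Let m ≥ 5 be a prime, let k be a positive integer, let r be an odd positive integer with r < m^k, and let ℓ be a prime different from 2, 3 and m. Then there exists a positive integer M such that for all nonnegative integers i and n for which 24 divides m^k·ℓ^i·n + r, one has p_r((m^k·ℓ^i·n + r)/24) ≡ p_r((m^k·ℓ^{2M+i}·n + r)/24) (mod m^k). (Note that 24 divides m^k·ℓ^i·n + r if and only if 24 divides m^k·ℓ^{2M+i}·n + r, since ℓ² ≡ 1 (mod 24).) -/

import Mathlib

/-- `multipartition r n` is the number of `r`-component multipartitions of `n`,
i.e. the number of `r`-tuples of integer partitions whose sizes sum to `n`. -/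
def multipartition (r n : ℕ) : ℕ :=
  ∑ c ∈ Finset.Nat.antidiagonalTuple r n, ∏ i, Fintype.card (Nat.Partition (c i))

section
open PowerSeries Finset

set_option maxHeartbeats 400000

/-- absolute convergence on the open unit disc -/
def Conv (A : ℂ⟦X⟧) : Prop := ∀ q : ℂ, ‖q‖ < 1 → Summable (fun n => ‖A.coeff n * q ^ n‖)

noncomputable def Ev (A : ℂ⟦X⟧) (q : ℂ) : ℂ := ∑' n, A.coeff n * q ^ n

theorem Conv.hasSum {A : ℂ⟦X⟧} (hA : Conv A) {q : ℂ} (hq : ‖q‖ < 1) :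
    HasSum (fun n => A.coeff n * q ^ n) (Ev A q) := (hA q hq).of_norm.hasSum

theorem Conv.of_summable {A : ℂ⟦X⟧} (h : ∀ q : ℂ, ‖q‖ < 1 → Summable (fun n => A.coeff n * q ^ n)) :
    Conv A := fun q hq => (h q hq).norm

theorem coeff_mul_pow (A B : ℂ⟦X⟧) (q : ℂ) (n : ℕ) : (A * B).coeff n * q ^ n =
    ∑ kl ∈ antidiagonal n, (A.coeff kl.1 * q ^ kl.1) * (B.coeff kl.2 * q ^ kl.2) := by
  rw [coeff_mul, Finset.sum_mul]
  refine Finset.sum_congr rfl fun x hx => ?_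
  rw [← Finset.HasAntidiagonal.mem_antidiagonal.mp hx, pow_add]; ring

theorem Conv.mul {A B : ℂ⟦X⟧} (hA : Conv A) (hB : Conv B) : Conv (A * B) := by
  intro q hq
  have h := summable_norm_sum_mul_antidiagonal_of_summable_norm (hA q hq) (hB q hq)
  refine h.congr (fun n => ?_)
  rw [coeff_mul_pow]

theorem Ev_mul {A B : ℂ⟦X⟧} (hA : Conv A) (hB : Conv B) {q : ℂ} (hq : ‖q‖ < 1) :
    Ev (A * B) q = Ev A q * Ev B q := by
  rw [Ev, Ev, Ev, tsum_mul_tsum_eq_tsum_sum_antidiagonal_of_summable_norm (hA q hq) (hB q hq)]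
  simp_rw [coeff_mul_pow]

theorem hasSum_one (q : ℂ) : HasSum (fun n => (1 : ℂ⟦X⟧).coeff n * q ^ n) 1 := by
  have := hasSum_single (f := fun n => (1 : ℂ⟦X⟧).coeff n * q ^ n) 0
    (by intro n hn; simp [coeff_one, hn])
  simpa using this

theorem Conv_one : Conv 1 := Conv.of_summable fun q _ => (hasSum_one q).summable
theorem Ev_one (q : ℂ) : Ev 1 q = 1 := (hasSum_one q).tsum_eq

theorem hasSum_X (q : ℂ) : HasSum (fun n => (X : ℂ⟦X⟧).coeff n * q ^ n) q := by
  have := hasSum_single (f := fun n => (X : ℂ⟦X⟧).coeff n * q ^ n) 1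
    (by intro n hn; simp [coeff_X, hn])
  simpa using this
theorem Conv_X : Conv X := Conv.of_summable fun q _ => (hasSum_X q).summable
theorem Ev_X (q : ℂ) : Ev X q = q := (hasSum_X q).tsum_eq

theorem Conv.pow {A : ℂ⟦X⟧} (hA : Conv A) (n : ℕ) : Conv (A ^ n) := by
  induction n with
  | zero => simpa using Conv_one
  | succ n ih => rw [pow_succ]; exact ih.mul hA

theorem Ev_pow {A : ℂ⟦X⟧} (hA : Conv A) (n : ℕ) {q : ℂ} (hq : ‖q‖ < 1) :
    Ev (A ^ n) q = Ev A q ^ n := by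
  induction n with
  | zero => simp [Ev_one]
  | succ n ih => rw [pow_succ, Ev_mul (hA.pow n) hA hq, ih, pow_succ]

theorem Conv.add {A B : ℂ⟦X⟧} (hA : Conv A) (hB : Conv B) : Conv (A + B) :=
  Conv.of_summable fun q hq => by
    simpa [add_mul] using (hA q hq).of_norm.add (hB q hq).of_norm

theorem Ev_add {A B : ℂ⟦X⟧} (hA : Conv A) (hB : Conv B) {q : ℂ} (hq : ‖q‖ < 1) :
    Ev (A + B) q = Ev A q + Ev B q := by
  rw [Ev, Ev, Ev, ← (hA q hq).of_norm.tsum_add (hB q hq).of_norm]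
  simp [add_mul]

theorem coeff_zsmul' (A : ℂ⟦X⟧) (c : ℤ) (n : ℕ) : ((c : ℂ⟦X⟧) * A).coeff n = c * A.coeff n := by
  rw [← zsmul_eq_mul, map_zsmul, zsmul_eq_mul]

theorem Conv.zsmul {A : ℂ⟦X⟧} (hA : Conv A) (c : ℤ) : Conv (c • A) :=
  Conv.of_summable fun q hq => by
    simpa [mul_assoc, coeff_zsmul'] using (hA q hq).of_norm.mul_left (c : ℂ)

theorem Ev_zsmul (A : ℂ⟦X⟧) (c : ℤ) (q : ℂ) : Ev (c • A) q = c * Ev A q := by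
  rw [Ev, Ev, ← tsum_mul_left]; simp [mul_assoc, coeff_zsmul']

theorem Conv.hasFPowerSeries {A : ℂ⟦X⟧} (hA : Conv A) :
    HasFPowerSeriesOnBall (Ev A) (FormalMultilinearSeries.ofScalars ℂ (fun n => A.coeff n)) 0 1 := by
  refine ⟨?_, one_pos, ?_⟩
  · refine ENNReal.le_of_forall_nnreal_lt fun r hr => ?_
    apply FormalMultilinearSeries.le_radius_of_summable
    have hr1 : (r : ℝ) < 1 := by exact_mod_cast hr
    have := hA (r : ℝ) (by simpa using hr1)
    simpa [FormalMultilinearSeries.ofScalars_norm] using this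
  · intro y hy
    have hy' : ‖y‖ < 1 := by
      have h1 : ‖y‖ₑ < 1 := by simpa [Metric.mem_eball, edist_zero_right] using hy
      rw [← ofReal_norm, ENNReal.ofReal_lt_one] at h1
      exact h1
    have := hA.hasSum hy'
    simpa [FormalMultilinearSeries.ofScalars_apply_eq, mul_comm] using this

theorem Conv.ext_eventually {A B : ℂ⟦X⟧} (hA : Conv A) (hB : Conv B)
    (h : ∀ q : ℂ, ‖q‖ < 1 → Ev A q = Ev B q) : A = B := by
  have h1 := hA.hasFPowerSeries.hasFPowerSeriesAt
  have h2 : HasFPowerSeriesAt (Ev A) _ 0 := hB.hasFPowerSeries.hasFPowerSeriesAt.congr (by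
    filter_upwards [Metric.ball_mem_nhds (0 : ℂ) one_pos] with q hq
    exact (h q (by simpa using hq)).symm)
  have h3 := h1.eq_formalMultilinearSeries h2
  ext n
  have := congr_arg (FormalMultilinearSeries.coeff · n) h3
  simpa using this

theorem Conv.differentiableOn {A : ℂ⟦X⟧} (hA : Conv A) :
    DifferentiableOn ℂ (Ev A) (Metric.ball 0 1) := by
  have := hA.hasFPowerSeries.differentiableOn
  rwa [← ENNReal.ofReal_one, Metric.eball_ofReal] at this

theorem Conv.exists_inv {A : ℂ⟦X⟧} (hA : Conv A) (h0 : ∀ q : ℂ, ‖q‖ < 1 → Ev A q ≠ 0) :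
    ∃ B : ℂ⟦X⟧, Conv B ∧ A * B = 1 := by
  have hd : DifferentiableOn ℂ (fun q => (Ev A q)⁻¹) (Metric.ball 0 1) :=
    hA.differentiableOn.inv (fun q hq => h0 q (by simpa using hq))
  let B : ℂ⟦X⟧ := PowerSeries.mk fun n => ((n.factorial : ℂ)⁻¹ * iteratedDeriv n (fun q => (Ev A q)⁻¹) 0)
  have hs : ∀ q : ℂ, ‖q‖ < 1 → HasSum (fun n => B.coeff n * q ^ n) ((Ev A q)⁻¹) := by
    intro q hq
    have := Complex.hasSum_taylorSeries_on_ball (r := 1) (c := 0) (by simpa using hd) (z := q) (by simpa using hq)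
    simpa [B, mul_comm, mul_assoc, mul_left_comm] using this
  have hB : Conv B := Conv.of_summable fun q hq => (hs q hq).summable
  refine ⟨B, hB, (hA.mul hB).ext_eventually Conv_one fun q hq => ?_⟩
  rw [Ev_mul hA hB hq, Ev_one, show Ev B q = _ from (hs q hq).tsum_eq, mul_inv_cancel₀ (h0 q hq)]

noncomputable abbrev cc : ℤ⟦X⟧ →+* ℂ⟦X⟧ := PowerSeries.map (Int.castRingHom ℂ)

theorem cc_inj {A B : ℤ⟦X⟧} (h : cc A = cc B) : A = B := by
  ext n
  have := congr_arg (PowerSeries.coeff n) h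
  simpa using this

noncomputable abbrev PP : ℤ⟦X⟧ := pentagonalSeries ℤ

theorem PP_coeff_zero : PP.coeff 0 = 1 := by
  have := coeff_pentagonalSeries_pentagonal ℤ 0
  simpa [pentagonal_def] using this

theorem Conv_PP : Conv (cc PP) := by
  intro q hq
  refine Summable.of_nonneg_of_le (fun _ => norm_nonneg _) (fun n => ?_)
    (summable_geometric_of_lt_one (norm_nonneg q) hq)
  rw [norm_mul, norm_pow]
  have : ‖(cc PP).coeff n‖ ≤ 1 := by
    by_cases h : n ∈ Set.range pentagonal
    · obtain ⟨k, rfl⟩ := h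
      simp only [coeff_map, coeff_pentagonalSeries_pentagonal]
      rcases Int.units_eq_one_or (Int.negOnePow k) with h | h <;> simp [h]
    · simp [coeff_pentagonalSeries_eq_zero ℤ h]
  exact mul_le_of_le_one_left (by positivity) this

theorem hasSum_PP_int {q : ℂ} (hq : ‖q‖ < 1) :
    HasSum (fun k : ℤ => ((Int.negOnePow k : ℤ) : ℂ) * q ^ pentagonal k) (Ev (cc PP) q) := by
  have h := Conv_PP.hasSum hq
  rw [← pentagonal_injective.hasSum_iff (fun n hn => by simp [coeff_pentagonalSeries_eq_zero ℤ hn])] at h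
  simpa [Function.comp_def] using h

theorem Ev_PP_eq_tprod {q : ℂ} (hq : ‖q‖ < 1) : Ev (cc PP) q = ∏' n : ℕ, (1 - q ^ (n + 1)) := by
  have h := hasSum_PP_int hq
  rw [← neg_injective.hasSum_iff (fun x hx ↦ by absurd hx; use -x; simp)] at h
  have h2 := h.nat_add_neg_add_one
  have h3 : HasSum (fun k : ℕ ↦ (-1) ^ k * (q ^ pentagonal (-k) - q ^ pentagonal (k + 1))) (Ev (cc PP) q) := by
    convert h2 using 2 with k
    simp_rw [Function.comp_apply, neg_neg, Int.negOnePow_add]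
    simp
    ring
  have hm : ∀ k : ℕ, Multipliable (fun n ↦ 1 - q ^ (n + k + 1)) := by
    intro k
    have : Summable fun n => ‖-q ^ (n + k + 1)‖ := by
      simp only [norm_neg, norm_pow]
      have := (summable_geometric_of_lt_one (norm_nonneg q) hq)
      exact (this.comp_injective (i := fun n => n + k + 1) (fun a b h => by simpa using h))
    simpa [sub_eq_add_neg] using multipliable_one_add_of_summable this
  have hg := summable_geometric_of_lt_one (norm_nonneg q) hq
  set M : ℝ := Real.exp (∑' n, ‖q‖ ^ n) with hMdef
  have hM' : ∀ k n : ℕ, ‖∏ i ∈ Finset.range (n + 1), (1 - q ^ (k + i + 1))‖ ≤ M := by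
    intro k n
    rw [norm_prod]
    calc ∏ i ∈ Finset.range (n + 1), ‖1 - q ^ (k + i + 1)‖
        ≤ ∏ i ∈ Finset.range (n + 1), Real.exp (‖q‖ ^ i) := by
          refine Finset.prod_le_prod (fun _ _ => norm_nonneg _) fun i _ => ?_
          calc ‖1 - q ^ (k + i + 1)‖ ≤ 1 + ‖q‖ ^ (k + i + 1) := by
                simpa using norm_sub_le (1 : ℂ) (q ^ (k + i + 1))
            _ ≤ ‖q‖ ^ i + 1 := by
                have := pow_le_pow_of_le_one (norm_nonneg q) hq.le (show i ≤ k + i + 1 by omega)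
                linarith
            _ ≤ _ := Real.add_one_le_exp _
      _ = Real.exp (∑ i ∈ Finset.range (n + 1), ‖q‖ ^ i) := (Real.exp_sum _ _).symm
      _ ≤ M := Real.exp_le_exp.mpr (hg.sum_le_tsum _ (fun _ _ => by positivity))
  have hb : ∀ k n : ℕ, ‖q ^ ((k + 1) * n) * ∏ i ∈ Finset.range (n + 1), (1 - q ^ (k + i + 1))‖ ≤
      ‖q‖ ^ n * M := by
    intro k n
    rw [norm_mul, norm_pow]
    refine mul_le_mul ?_ (hM' k n) (norm_nonneg _) (by positivity)
    exact pow_le_pow_of_le_one (norm_nonneg _) hq.le (Nat.le_mul_of_pos_left n (Nat.succ_pos k))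
  have hs : ∀ k, Summable
      (fun n ↦ q ^ ((k + 1) * n) * ∏ i ∈ Finset.range (n + 1), (1 - q ^ (k + i + 1))) := fun k =>
    Summable.of_norm_bounded (g := fun n => ‖q‖ ^ n * M) (hg.mul_right M) (hb k)
  have := Pentagonal.tprod_one_sub_pow (x := q) (by
    rw [IsTopologicallyNilpotent]; exact tendsto_pow_atTop_nhds_zero_of_norm_lt_one hq) hs hm h3.summable
  rw [this, ← h3.tsum_eq]
  rw [tendsto_zero_iff_norm_tendsto_zero]
  refine squeeze_zero (g := fun k => ‖q‖ ^ k * ∑' n, ‖q‖ ^ n * M) (fun _ => norm_nonneg _) (fun k => ?_) ?_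
  · rw [norm_mul]
    refine mul_le_mul ?_ ?_ (norm_nonneg _) (by positivity)
    · rw [norm_mul, norm_pow, norm_pow, norm_neg, norm_one, one_pow, one_mul]
      refine pow_le_pow_of_le_one (norm_nonneg _) hq.le ?_
      rw [Nat.le_div_iff_mul_le two_pos]; nlinarith
    · exact tsum_of_norm_bounded (hg.mul_right M).hasSum (hb k)
  · simpa using (tendsto_pow_atTop_nhds_zero_of_lt_one (norm_nonneg q) hq).mul_const _

/-- `exp (2 π i z)` -/
noncomputable def ee (z : ℂ) : ℂ := Complex.exp (2 * Real.pi * Complex.I * z)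

theorem ee_add (x y : ℂ) : ee (x + y) = ee x * ee y := by
  rw [ee, ee, ee, ← Complex.exp_add]; ring_nf
theorem ee_zero : ee 0 = 1 := by simp [ee]
theorem ee_nat_mul (n : ℕ) (x : ℂ) : ee (n * x) = ee x ^ n := by
  rw [ee, ee, ← Complex.exp_nat_mul]; ring_nf
theorem ee_int_mul (n : ℤ) (x : ℂ) : ee (n * x) = ee x ^ n := by
  rw [ee, ee, ← Complex.exp_int_mul]; ring_nf
theorem ee_int (n : ℤ) : ee n = 1 := by
  rw [ee, Complex.exp_eq_one_iff]; exact ⟨n, by ring⟩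
theorem ee_add_int (x : ℂ) (n : ℤ) : ee (x + n) = ee x := by rw [ee_add, ee_int, mul_one]
theorem ee_ne_zero (x : ℂ) : ee x ≠ 0 := Complex.exp_ne_zero _
theorem ee_norm_lt {z : ℂ} (hz : 0 < z.im) : ‖ee z‖ < 1 := by
  rw [ee, Complex.norm_exp, Real.exp_lt_one_iff]
  have : (2 * Real.pi * Complex.I * z).re = - (2 * Real.pi * z.im) := by simp
  rw [this]; have := Real.pi_pos; simp; positivity

open ModularForm in
theorem eta_eq {z : ℂ} (hz : 0 < z.im) : eta z = ee (z / 24) * Ev (cc PP) (ee z) := by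
  rw [Ev_PP_eq_tprod (ee_norm_lt hz), eta]
  congr 1
  · simp only [Function.Periodic.qParam, ee]; congr 1; push_cast; ring
  · simp only [eta_q_eq_pow, ee]

theorem Ev_PP_ne_zero {q : ℂ} (hq : ‖q‖ < 1) : Ev (cc PP) q ≠ 0 := by
  rw [Ev_PP_eq_tprod hq]
  have hs : Summable fun n : ℕ => ‖-q ^ (n + 1)‖ := by
    simp only [norm_neg, norm_pow]
    exact (summable_nat_add_iff 1).mpr (summable_geometric_of_lt_one (norm_nonneg q) hq)
  have := tprod_one_add_ne_zero_of_summable (f := fun n : ℕ => -q ^ (n + 1)) (fun n h => ?_) hs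
  · simpa [sub_eq_add_neg] using this
  · have h2 : q ^ (n + 1) = 1 := by linear_combination -h
    have h3 := congr_arg norm h2
    rw [norm_pow, norm_one] at h3
    exact absurd h3 (pow_lt_one₀ (norm_nonneg _) hq (by omega)).ne

/-- integral inverse of `PP` -/
theorem exists_PP_inv : ∃ Q : ℤ⟦X⟧, PP * Q = 1 ∧ Conv (cc Q) := by
  have hu : IsUnit PP := by
    rw [PowerSeries.isUnit_iff_constantCoeff, ← coeff_zero_eq_constantCoeff_apply, PP_coeff_zero]
    exact isUnit_one
  obtain ⟨Q, hQ⟩ := hu.exists_right_inv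
  obtain ⟨B, hB, hPB⟩ := Conv_PP.exists_inv (fun q hq => Ev_PP_ne_zero hq)
  refine ⟨Q, hQ, ?_⟩
  have h2 : cc PP * cc Q = 1 := by rw [← map_mul, hQ, map_one]
  have : cc Q = B := by
    calc cc Q = cc Q * (cc PP * B) := by rw [hPB, mul_one]
      _ = (cc PP * cc Q) * B := by ring
      _ = B := by rw [h2, one_mul]
  rwa [this]

noncomputable def pser : ℤ⟦X⟧ := PowerSeries.mk fun n => (Fintype.card (Nat.Partition n) : ℤ)

open scoped PowerSeries.WithPiTopology in
theorem pser_mul_PP : pser * PP = 1 := by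
  let : TopologicalSpace ℤ := ⊥
  have : DiscreteTopology ℤ := ⟨rfl⟩
  have h1 := Nat.Partition.hasProd_powerSeriesMk_card_restricted ℤ (fun _ => True)
  have h2 := PowerSeries.WithPiTopology.hasProd_one_sub_X_pow ℤ
  have h3 := h1.mul h2
  have h4 : (PowerSeries.mk fun n ↦ (((Nat.Partition.restricted n (fun _ => True)).card : ℕ) : ℤ)) = pser := by
    ext n; simp [pser, Nat.Partition.restricted]
  rw [h4] at h3
  refine h3.unique ?_
  convert! hasProd_one using 2 with i
  simp only [if_true]
  have := PowerSeries.WithPiTopology.tsum_pow_mul_one_sub_of_constantCoeff_eq_zero (f := (X : ℤ⟦X⟧) ^ (i+1)) (by simp)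
  simpa [pow_mul] using this

noncomputable def mser (r : ℕ) : ℤ⟦X⟧ := PowerSeries.mk fun n => (multipartition r n : ℤ)

theorem mser_eq (r : ℕ) : mser r = pser ^ r := by
  ext n
  have : pser ^ r = ∏ _i : Fin r, pser := by simp
  rw [this, coeff_prod, mser, coeff_mk, multipartition]
  push_cast
  refine Finset.sum_bij' (fun c _ => Finsupp.equivFunOnFinite.symm c) (fun l _ => l) ?_ ?_ ?_ ?_ ?_
  · intro c hc
    rw [Finset.Nat.mem_antidiagonalTuple] at hc
    rw [Finset.mem_finsuppAntidiag]
    exact ⟨by simpa using hc, by simp⟩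
  · intro l hl
    rw [Finset.mem_finsuppAntidiag] at hl
    rw [Finset.Nat.mem_antidiagonalTuple]; simpa using hl.1
  · intro c _; simp
  · intro l _; simp
  · intro c _; simp [pser]

theorem mser_mul_PP (r : ℕ) : mser r * PP ^ r = 1 := by
  rw [mser_eq, ← mul_pow, pser_mul_PP, one_pow]

theorem natCast_dvd_iff (M : ℕ) (A : ℤ⟦X⟧) : (M : ℤ⟦X⟧) ∣ A ↔ ∀ n, (M : ℤ) ∣ A.coeff n := by
  constructor
  · rintro ⟨B, rfl⟩ n
    rw [← nsmul_eq_mul, map_nsmul, nsmul_eq_mul]; exact dvd_mul_right _ _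
  · intro h
    choose f hf using h
    refine ⟨PowerSeries.mk f, ?_⟩
    ext n
    rw [← nsmul_eq_mul, map_nsmul, nsmul_eq_mul, coeff_mk, hf]


theorem frob (p : ℕ) (hp : p.Prime) (A : ℤ⟦X⟧) : (p : ℤ⟦X⟧) ∣ A ^ p - expand p hp.ne_zero A := by
  have : Fact p.Prime := ⟨hp⟩
  rw [natCast_dvd_iff]
  intro n
  rw [← ZMod.intCast_zmod_eq_zero_iff_dvd]
  have h : expand p hp.ne_zero (PowerSeries.map (Int.castRingHom (ZMod p)) A) =
      (PowerSeries.map (Int.castRingHom (ZMod p)) A) ^ p := by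
    have := MvPowerSeries.map_frobenius_expand p hp.ne_zero (f := PowerSeries.map (Int.castRingHom (ZMod p)) A)
    rw [ZMod.frobenius_zmod] at this
    rw [← this, expand]; rfl
  rw [← PowerSeries.map_expand, ← map_pow] at h
  have := congr_arg (PowerSeries.coeff n) h
  simp only [coeff_map, eq_intCast] at this
  rw [map_sub, Int.cast_sub, this, sub_self]

theorem frob_iter (p : ℕ) (hp : p.Prime) (A : ℤ⟦X⟧) (j : ℕ) :
    (p : ℤ⟦X⟧) ∣ A ^ (p ^ j) - expand (p ^ j) (pow_ne_zero j hp.ne_zero) A := by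
  induction j with
  | zero => simp
  | succ j ih =>
    have h1 := frob p hp (A ^ (p ^ j))
    obtain ⟨B, hB⟩ := ih
    have h2 : (p : ℤ⟦X⟧) ∣ expand p hp.ne_zero (A ^ (p ^ j)) - expand (p ^ (j+1)) (pow_ne_zero _ hp.ne_zero) A := by
      have : expand (p ^ (j+1)) (pow_ne_zero _ hp.ne_zero) A =
          expand p hp.ne_zero (expand (p ^ j) (pow_ne_zero j hp.ne_zero) A) := by
        rw [← expand_mul]; congr 1; simp only [pow_succ']
      rw [this, ← map_sub, hB, map_mul, map_natCast]
      exact dvd_mul_right _ _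
    have h3 := dvd_add h1 h2
    rw [sub_add_sub_cancel, ← pow_mul, ← pow_succ] at h3
    exact h3

theorem frob_pow (p : ℕ) (hp : p.Prime) (A : ℤ⟦X⟧) (k : ℕ) (hk : 0 < k) (c : ℕ) :
    ((p ^ k : ℕ) : ℤ⟦X⟧) ∣ A ^ (p ^ (2 * k - 1) * c) -
      expand (p ^ k) (pow_ne_zero k hp.ne_zero) (A ^ (p ^ (k - 1) * c)) := by
  have h := dvd_sub_pow_of_dvd_sub (frob_iter p hp A k) (k - 1)
  have h2 := h.trans (sub_dvd_pow_sub_pow _ _ c)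
  rw [← pow_mul, ← pow_mul, ← map_pow, ← map_pow, ← pow_mul] at h2
  rw [Nat.sub_add_cancel hk, ← mul_assoc, ← pow_add] at h2
  rw [show 2 * k - 1 = k + (k - 1) by omega]
  exact_mod_cast h2

noncomputable def UU (N : ℕ) (A : ℤ⟦X⟧) : ℤ⟦X⟧ := PowerSeries.mk fun n => A.coeff (N * n)

theorem UU_sub (N : ℕ) (A B : ℤ⟦X⟧) : UU N (A - B) = UU N A - UU N B := by
  ext n; simp [UU]

theorem UU_expand_mul (N : ℕ) (hN : N ≠ 0) (A B : ℤ⟦X⟧) :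
    UU N (expand N hN B * A) = B * UU N A := by
  ext n
  rw [UU, coeff_mk, coeff_mul, coeff_mul]
  symm
  refine Finset.sum_of_injOn (fun x => (N * x.1, N * x.2)) ?_ ?_ ?_ ?_
  · rintro ⟨a, b⟩ _ ⟨a', b'⟩ _ h
    simp only [Prod.mk.injEq, mul_eq_mul_left_iff, hN, or_false] at h
    exact Prod.ext h.1 h.2
  · rintro ⟨a, b⟩ h
    simp only [SetLike.mem_coe, HasAntidiagonal.mem_antidiagonal] at h ⊢
    rw [← mul_add, h]
  · rintro ⟨a, b⟩ h h'
    simp only [HasAntidiagonal.mem_antidiagonal] at h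
    by_cases hd : N ∣ a
    · exfalso
      obtain ⟨x, rfl⟩ := hd
      obtain ⟨y, rfl⟩ : N ∣ b := (Nat.dvd_add_right (dvd_mul_right N x)).mp (h ▸ dvd_mul_right N n)
      apply h'
      refine ⟨(x, y), ?_, rfl⟩
      simp only [SetLike.mem_coe, HasAntidiagonal.mem_antidiagonal]
      rw [← mul_add] at h
      exact Nat.eq_of_mul_eq_mul_left (Nat.pos_of_ne_zero hN) h
    · rw [coeff_expand_of_not_dvd _ _ _ hd, zero_mul]
  · rintro ⟨a, b⟩ _
    simp [UU, coeff_expand_mul]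

theorem UU_dvd (N M : ℕ) (A : ℤ⟦X⟧) (h : (M : ℤ⟦X⟧) ∣ A) : (M : ℤ⟦X⟧) ∣ UU N A := by
  rw [natCast_dvd_iff] at h ⊢
  intro n; simpa [UU] using h (N * n)

noncomputable def DD : ℤ⟦X⟧ := X * PP ^ 24

theorem key_congr (m k r c b C : ℕ) (hm : m.Prime) (hk : 0 < k)
    (hb : m ^ (2 * k - 1) * c = 24 * b + r) (hC : C = m ^ (k - 1) * c) :
    ((m ^ k : ℕ) : ℤ⟦X⟧) ∣ UU (m ^ k) (X ^ b * mser r) * PP ^ C - UU (m ^ k) (DD ^ b) := by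
  have h := frob_pow m hm PP k hk c
  rw [← hC, hb] at h
  have h2 : ((m ^ k : ℕ) : ℤ⟦X⟧) ∣ expand (m ^ k) (pow_ne_zero k hm.ne_zero) (PP ^ C) * (X ^ b * mser r) -
      DD ^ b := by
    have h3 : DD ^ b = PP ^ (24 * b + r) * (X ^ b * mser r) := by
      calc DD ^ b = X ^ b * PP ^ (24 * b) * 1 := by rw [DD, mul_pow, ← pow_mul, mul_one]
        _ = X ^ b * PP ^ (24 * b) * (mser r * PP ^ r) := by rw [mser_mul_PP]
        _ = _ := by rw [pow_add]; ring
    rw [h3, ← sub_mul]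
    exact (dvd_sub_comm.mp h).mul_right _
  have h3 := UU_dvd (m ^ k) _ _ h2
  rwa [UU_sub, UU_expand_mul, mul_comm] at h3

theorem PP_isUnit : IsUnit PP := by
  obtain ⟨Q, hQ, _⟩ := exists_PP_inv
  exact IsUnit.of_mul_eq_one _ hQ

theorem coeff_low (m k r c b C r' e : ℕ) (hm : m.Prime) (hk : 0 < k) (hrm : r < m ^ k)
    (hb : m ^ (2 * k - 1) * c = 24 * b + r) (hC : C = m ^ (k - 1) * c) (hr' : r' < 24)
    (he : C + r' = 24 * e) (i : ℕ) (hi : i < e) :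
    ((m ^ k : ℕ) : ℤ) ∣ (UU (m ^ k) (DD ^ b)).coeff i := by
  have h := key_congr m k r c b C hm hk hb hC
  rw [natCast_dvd_iff] at h
  have h2 := h i
  have h3 : m ^ k * C = 24 * b + r := by
    rw [hC, ← mul_assoc, ← pow_add, ← hb]; congr 2; omega
  have h1 : (UU (m ^ k) (X ^ b * mser r) * PP ^ C).coeff i = 0 := by
    rw [coeff_mul]
    refine Finset.sum_eq_zero fun x hx => ?_
    rw [HasAntidiagonal.mem_antidiagonal] at hx
    rw [UU, coeff_mk, coeff_X_pow_mul', if_neg, zero_mul]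
    rw [not_le]
    have h4 : x.1 + 1 ≤ e := by omega
    have h5 := Nat.mul_le_mul_left (m ^ k) h4
    have h6 : m ^ k * (C + r') = m ^ k * (24 * e) := by rw [he]
    have h7 : m ^ k * r' ≤ m ^ k * 23 := Nat.mul_le_mul_left _ (by omega)
    rw [mul_add] at h5 h6
    have h8 : m ^ k * (24 * e) = 24 * (m ^ k * e) := by ring
    omega
  rw [map_sub, h1, zero_sub, dvd_neg] at h2
  exact h2

theorem coeff_main (m k r c b C r' e : ℕ) (hm : m.Prime) (hk : 0 < k)
    (hb : m ^ (2 * k - 1) * c = 24 * b + r) (hC : C = m ^ (k - 1) * c)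
    (he : C + r' = 24 * e) (f : ℤ⟦X⟧)
    (hf : ((m ^ k : ℕ) : ℤ⟦X⟧) ∣ f * DD ^ e - UU (m ^ k) (DD ^ b)) (j : ℕ) :
    ((m ^ k : ℕ) : ℤ) ∣ (f * PP ^ r').coeff j -
      multipartition r ((m ^ k * (24 * j + r') + r) / 24) := by
  have h := key_congr m k r c b C hm hk hb hC
  have h2 := dvd_sub hf h
  have h3 : m ^ k * C = 24 * b + r := by
    rw [hC, ← mul_assoc, ← pow_add, ← hb]; congr 2; omega
  have h4 : f * DD ^ e - UU (m ^ k) (DD ^ b) -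
      (UU (m ^ k) (X ^ b * mser r) * PP ^ C - UU (m ^ k) (DD ^ b)) =
      (X ^ e * (f * PP ^ r') - UU (m ^ k) (X ^ b * mser r)) * PP ^ C := by
    rw [DD, mul_pow, ← pow_mul, ← he, pow_add]; ring
  rw [h4, (PP_isUnit.pow C).dvd_mul_right, natCast_dvd_iff] at h2
  have h5 := h2 (j + e)
  rw [map_sub, coeff_X_pow_mul, UU, coeff_mk, coeff_X_pow_mul', if_pos, mser, coeff_mk] at h5
  · convert h5 using 4
    have h6 : m ^ k * (C + r') = m ^ k * (24 * e) := by rw [he]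
    rw [mul_add] at h6
    have h8 : m ^ k * (24 * e) = 24 * (m ^ k * e) := by ring
    have h9 : m ^ k * (24 * j + r') = 24 * (m ^ k * j) + m ^ k * r' := by ring
    rw [h9, mul_add]
    omega
  · have h6 : m ^ k * (C + r') = m ^ k * (24 * e) := by rw [he]
    rw [mul_add] at h6
    have h8 : m ^ k * (24 * e) = 24 * (m ^ k * e) := by ring
    rw [mul_add]
    omega

def MF (w : ℕ) (A : ℤ⟦X⟧) : Prop :=
  Conv (cc A) ∧ ∀ z : ℂ, 0 < z.im → Ev (cc A) (ee (-1 / z)) = z ^ w * Ev (cc A) (ee z)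

theorem im_S {z : ℂ} (hz : 0 < z.im) : 0 < (-1 / z).im := by
  have : z ≠ 0 := by rintro rfl; simp at hz
  rw [neg_div, one_div, Complex.neg_im, Complex.inv_im]
  have := Complex.normSq_pos.mpr this
  rw [neg_div, neg_neg]; positivity

theorem MF.add {w : ℕ} {A B : ℤ⟦X⟧} (hA : MF w A) (hB : MF w B) : MF w (A + B) := by
  refine ⟨by rw [map_add]; exact hA.1.add hB.1, fun z hz => ?_⟩
  rw [map_add, Ev_add hA.1 hB.1 (ee_norm_lt hz), Ev_add hA.1 hB.1 (ee_norm_lt (im_S hz)),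
    hA.2 z hz, hB.2 z hz]; ring

theorem MF.zsmul {w : ℕ} {A : ℤ⟦X⟧} (hA : MF w A) (c : ℤ) : MF w (c • A) := by
  refine ⟨by rw [map_zsmul]; exact hA.1.zsmul c, fun z hz => ?_⟩
  rw [map_zsmul, Ev_zsmul, Ev_zsmul, hA.2 z hz]; ring

theorem MF.sub {w : ℕ} {A B : ℤ⟦X⟧} (hA : MF w A) (hB : MF w B) : MF w (A - B) := by
  have := hA.add (hB.zsmul (-1))
  simpa [sub_eq_add_neg] using this

theorem MF.zero (w : ℕ) : MF w 0 := by
  constructor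
  · intro q _; simp
  · intro z _; simp [Ev]

theorem MF.mul {w v : ℕ} {A B : ℤ⟦X⟧} (hA : MF w A) (hB : MF v B) : MF (w + v) (A * B) := by
  refine ⟨by rw [map_mul]; exact hA.1.mul hB.1, fun z hz => ?_⟩
  rw [map_mul, Ev_mul hA.1 hB.1 (ee_norm_lt hz), Ev_mul hA.1 hB.1 (ee_norm_lt (im_S hz)),
    hA.2 z hz, hB.2 z hz]; ring

theorem MF.one : MF 0 1 := by
  constructor
  · rw [map_one]; exact Conv_one
  · intro z _; simp [Ev_one]

theorem MF.pow {w : ℕ} {A : ℤ⟦X⟧} (hA : MF w A) (n : ℕ) : MF (w * n) (A ^ n) := by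
  induction n with
  | zero => simpa using MF.one
  | succ n ih => rw [pow_succ, mul_add, mul_one]; exact ih.mul hA

theorem Conv_DD : Conv (cc DD) := by
  rw [DD, map_mul, map_pow, PowerSeries.map_X]; exact Conv_X.mul (Conv_PP.pow 24)

theorem Ev_DD {q : ℂ} (hq : ‖q‖ < 1) : Ev (cc DD) q = q * Ev (cc PP) q ^ 24 := by
  rw [DD, map_mul, map_pow, PowerSeries.map_X, Ev_mul Conv_X (Conv_PP.pow 24) hq, Ev_X, Ev_pow Conv_PP _ hq]

theorem Ev_DD_eta {z : ℂ} (hz : 0 < z.im) : Ev (cc DD) (ee z) = ModularForm.eta z ^ 24 := by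
  rw [Ev_DD (ee_norm_lt hz), eta_eq hz, mul_pow, ← ee_nat_mul]
  congr 2; push_cast; ring

theorem csqrt24 {z : ℂ} (hz : z ≠ 0) : Complex.sqrt z ^ 24 = z ^ 12 := by
  rw [Complex.sqrt, ← Complex.cpow_nat_mul, ← Complex.cpow_natCast]
  congr 1; norm_num

theorem MF_DD : MF 12 DD := by
  refine ⟨Conv_DD, fun z hz => ?_⟩
  have h0 : z ≠ 0 := by rintro rfl; simp at hz
  rw [Ev_DD_eta hz, Ev_DD_eta (im_S hz)]
  have he : ModularForm.eta (-1 / z) = (Complex.sqrt Complex.I)⁻¹ * (Complex.sqrt z * ModularForm.eta z) := by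
    simpa using ModularForm.eta_comp_eq_csqrt_I_inv (show z ∈ UpperHalfPlane.upperHalfPlaneSet from hz)
  rw [he, mul_pow, mul_pow, inv_pow, csqrt24 Complex.I_ne_zero, csqrt24 h0,
    show 12 = 4 * 3 by norm_num, pow_mul Complex.I, Complex.I_pow_four]
  simp

/-- function on the upper half plane -/
noncomputable def ff (A : ℤ⟦X⟧) (τ : UpperHalfPlane) : ℂ := Ev (cc A) (ee τ)

open UpperHalfPlane ModularForm MatrixGroups SlashInvariantForm in
theorem ff_S {w : ℕ} {A : ℤ⟦X⟧} (hA : MF w A) : ff A ∣[(w : ℤ)] ModularGroup.S = ff A := by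
  ext z
  have h := hA.2 z z.2
  rw [SL_slash_apply, UpperHalfPlane.modular_S_smul]
  have h1 : ff A (UpperHalfPlane.mk (-(z:ℂ))⁻¹ z.im_inv_neg_coe_pos) = (z:ℂ) ^ w * ff A z := by
    rw [ff, ff, ← h]; congr 2; simp [neg_div]
  rw [h1]
  have : (z : ℂ) ≠ 0 := z.ne_zero
  simp [ModularGroup.denom_S]
  field_simp

open UpperHalfPlane ModularForm MatrixGroups SlashInvariantForm in
theorem ff_T {w : ℕ} {A : ℤ⟦X⟧} : ff A ∣[(w : ℤ)] ModularGroup.T = ff A := by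
  ext z
  have hd : denom (ModularGroup.T : SL(2, ℤ)) z = 1 := by
    rw [ModularGroup.denom_apply]; simp [ModularGroup.T]
  rw [SL_slash_apply, hd, modular_T_smul, ff, ff]
  have := ee_add_int z 1
  simpa [add_comm] using congr_arg (Ev (cc A)) this

open UpperHalfPlane ModularForm MatrixGroups SlashInvariantForm in
theorem ff_hasSum {w : ℕ} {A : ℤ⟦X⟧} (hA : MF w A) (τ : ℍ) :
    HasSum (fun m ↦ (A.coeff m : ℂ) • Function.Periodic.qParam 1 τ ^ m) (ff A τ) := by
  have := hA.1.hasSum (ee_norm_lt τ.2)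
  simpa [ff, ee, Function.Periodic.qParam] using this

open UpperHalfPlane ModularForm MatrixGroups SlashInvariantForm in
noncomputable def toM {w : ℕ} {A : ℤ⟦X⟧} (hA : MF w A) : ModularForm 𝒮ℒ (w : ℤ) where
  toFun := ff A
  slash_action_eq' g hg := by
    obtain ⟨g, rfl⟩ := hg
    exact slash_action_generators_SL2Z (ff_S hA) ff_T g
  holo' := by
    rw [UpperHalfPlane.mdifferentiable_iff]
    have h1 : DifferentiableOn ℂ (fun z => Ev (cc A) (ee z)) {z | 0 < z.im} := by
      refine hA.1.differentiableOn.comp (t := Metric.ball 0 1) ?_ ?_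
      · have : Differentiable ℂ ee := by unfold ee; fun_prop
        exact this.differentiableOn
      · intro z hz; simpa using ee_norm_lt hz
    refine h1.congr fun z hz => ?_
    simp [ff, ofComplex_apply_of_im_pos hz]
  bdd_at_cusps' hc := by
    rw [Subgroup.IsArithmetic.isCusp_iff_isCusp_SL2Z] at hc
    rw [OnePoint.isBoundedAt_iff_forall_SL2Z hc]
    intro γ _
    rw [slash_action_generators_SL2Z (ff_S hA) ff_T]
    exact isBoundedAtImInfty_of_hasSum_qExpansion one_pos (ff_hasSum hA)

open UpperHalfPlane ModularForm MatrixGroups SlashInvariantForm in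
theorem MF.action {w : ℕ} {A : ℤ⟦X⟧} (hA : MF w A) (a b c d : ℤ) (hd : a * d - b * c = 1)
    {z : ℂ} (hz : 0 < z.im) :
    Ev (cc A) (ee ((a * z + b) / (c * z + d))) = (c * z + d) ^ w * Ev (cc A) (ee z) := by
  let g : SL(2, ℤ) := ⟨!![a, b; c, d], by rw [Matrix.det_fin_two_of]; exact hd⟩
  have h := congr_fun (slash_action_generators_SL2Z (ff_S hA) ff_T g) (UpperHalfPlane.mk z hz)
  rw [SL_slash_apply] at h
  have hden : denom g (UpperHalfPlane.mk z hz) ≠ 0 := denom_ne_zero _ _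
  have h2 : denom g (UpperHalfPlane.mk z hz) = c * z + d := by
    rw [ModularGroup.denom_apply]; simp [g]
  have h3 : ff A (g • (UpperHalfPlane.mk z hz)) = Ev (cc A) (ee ((a * z + b) / (c * z + d))) := by
    rw [ff, UpperHalfPlane.coe_specialLinearGroup_apply]; simp [g]
  rw [h2, h3] at h
  rw [h2] at hden
  rw [show Ev (cc A) (ee z) = ff A (UpperHalfPlane.mk z hz) from rfl, ← h, zpow_neg, zpow_natCast, mul_left_comm,
    mul_inv_cancel₀ (pow_ne_zero w hden), mul_one]

open UpperHalfPlane ModularForm MatrixGroups SlashInvariantForm in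
theorem MF.sturm {w : ℕ} {A : ℤ⟦X⟧} (hA : MF w A) (h : ∀ n ≤ w / 12, A.coeff n = 0) : A = 0 := by
  have hc : ∀ m, (A.coeff m : ℂ) = (qExpansion 1 (toM hA)).coeff m := fun m =>
    ModularFormClass.qExpansion_coeff_unique one_pos one_mem_strictPeriods_SL (f := toM hA)
      (c := fun m => (A.coeff m : ℂ)) (ff_hasSum hA) m
  have h0 : toM hA = 0 := by
    apply sturm_bound_levelOne_nat
    have : ((w / 12 + 1 : ℕ) : ℕ∞) ≤ (qExpansion 1 (toM hA)).order := by
      refine PowerSeries.nat_le_order _ _ fun i hi => ?_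
      rw [← hc, h i (by omega)]; simp
    refine lt_of_lt_of_le ?_ this
    exact_mod_cast Nat.lt_succ_self _
  have hz : ∀ z : ℂ, 0 < z.im → Ev (cc A) (ee z) = 0 := fun z hz => by
    have := DFunLike.congr_fun h0 (UpperHalfPlane.mk z hz)
    exact this
  ext m
  have := hc m
  rw [h0] at this
  have h5 : ((A.coeff m : ℤ) : ℂ) = 0 := by rw [this]; simp [qExpansion_zero]
  exact_mod_cast h5

theorem exists_ee {q : ℂ} (hq0 : q ≠ 0) (hq : ‖q‖ < 1) : ∃ z : ℂ, 0 < z.im ∧ ee z = q := by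
  have hpi : (2 * Real.pi * Complex.I : ℂ) ≠ 0 := Complex.two_pi_I_ne_zero
  refine ⟨Complex.log q / (2 * Real.pi * Complex.I), ?_, ?_⟩
  · have h1 : (Complex.log q / (2 * Real.pi * Complex.I)).im = - Real.log ‖q‖ / (2 * Real.pi) := by
      have : Complex.log q / (2 * Real.pi * Complex.I) =
          ((-1 / (2 * Real.pi) : ℝ) : ℂ) * (Complex.log q * Complex.I) := by
        have hp : (Real.pi : ℂ) ≠ 0 := by exact_mod_cast Real.pi_ne_zero
        have := Complex.I_ne_zero
        push_cast
        field_simp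
        linear_combination (Complex.log q) * Complex.I_sq
      rw [this, Complex.im_ofReal_mul]
      simp [Complex.log_re]; ring
    rw [h1]
    have := Real.log_neg (norm_pos_iff.mpr hq0) hq
    have := Real.pi_pos
    exact div_pos (by linarith) (by linarith)
  · rw [ee, mul_div_cancel₀ _ hpi, Complex.exp_log hq0]

theorem Conv.of_H {A : ℂ⟦X⟧} (h : ∀ z : ℂ, 0 < z.im → Summable fun n => A.coeff n * ee z ^ n) :
    Conv A := by
  refine Conv.of_summable fun q hq => ?_
  by_cases hq0 : q = 0
  · subst hq0
    refine summable_of_hasFiniteSupport ((Set.finite_singleton 0).subset fun n hn => ?_)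
    by_contra h0
    simp at h0
    simp [h0] at hn
  · obtain ⟨z, hz, rfl⟩ := exists_ee hq0 hq
    exact h z hz

theorem Conv.ext_H {A B : ℂ⟦X⟧} (hA : Conv A) (hB : Conv B)
    (h : ∀ z : ℂ, 0 < z.im → Ev A (ee z) = Ev B (ee z)) : A = B := by
  have : X * A = X * B := by
    refine (Conv_X.mul hA).ext_eventually (Conv_X.mul hB) fun q hq => ?_
    rw [Ev_mul Conv_X hA hq, Ev_mul Conv_X hB hq, Ev_X]
    by_cases hq0 : q = 0
    · simp [hq0]
    · obtain ⟨z, hz, rfl⟩ := exists_ee hq0 hq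
      rw [h z hz]
  exact mul_left_cancel₀ PowerSeries.X_ne_zero this

theorem ee_eq_one_iff {m : ℕ} (hm : m ≠ 0) (n : ℤ) : ee (n / m) = 1 ↔ (m : ℤ) ∣ n := by
  have hm' : (m : ℂ) ≠ 0 := by exact_mod_cast hm
  rw [ee, Complex.exp_eq_one_iff]
  constructor
  · rintro ⟨k, hk⟩
    refine ⟨k, ?_⟩
    have h1 : (n : ℂ) / m = k := by
      apply mul_left_cancel₀ Complex.two_pi_I_ne_zero
      rw [hk]; ring
    rw [div_eq_iff hm'] at h1
    have : ((n : ℤ) : ℂ) = ((m * k : ℤ) : ℂ) := by rw [h1]; push_cast; ring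
    exact_mod_cast this
  · rintro ⟨k, rfl⟩
    refine ⟨k, ?_⟩
    push_cast; field_simp

theorem sum_roots {m : ℕ} (hm : m ≠ 0) (n : ℤ) :
    ∑ b ∈ range m, ee (n * b / m) = if (m : ℤ) ∣ n then (m : ℂ) else 0 := by
  have h1 : ∀ b : ℕ, ee (n * b / m) = ee (n / m) ^ b := fun b => by
    rw [← ee_nat_mul]; congr 1; ring
  simp_rw [h1]
  split_ifs with h
  · rw [(ee_eq_one_iff hm n).mpr h]; simp
  · have hne : ee (n / m) ≠ 1 := fun h' => h ((ee_eq_one_iff hm n).mp h')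
    rw [geom_sum_eq hne, ← ee_nat_mul]
    have : (m : ℂ) * (n / m) = n := by
      have hm' : (m : ℂ) ≠ 0 := by exact_mod_cast hm
      field_simp
    rw [this, ee_int]; simp

theorem sum_zmod_val {m : ℕ} [NeZero m] (f : ℕ → ℂ) : ∑ b : ZMod m, f b.val = ∑ b ∈ range m, f b := by
  refine Finset.sum_bij' (fun b _ => b.val) (fun b _ => (b : ZMod m)) ?_ ?_ ?_ ?_ ?_
  · intro b _; simpa using ZMod.val_lt b
  · intro b _; simp
  · intro b _; simp
  · intro b hb; exact ZMod.val_cast_of_lt (by simpa using hb)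
  · intro b _; rfl

theorem im_div_nat {z : ℂ} (hz : 0 < z.im) {m : ℕ} (hm : m ≠ 0) (b : ℤ) : 0 < ((z + b) / m).im := by
  have : (z + b) / m = ((1 / (m : ℝ) : ℝ) : ℂ) * (z + b) := by push_cast; ring
  rw [this, Complex.im_ofReal_mul]
  have : (0:ℝ) < m := by exact_mod_cast Nat.pos_of_ne_zero hm
  simp; positivity

theorem im_nat_mul {z : ℂ} (hz : 0 < z.im) {m : ℕ} (hm : m ≠ 0) : 0 < (m * z).im := by
  have : (m : ℂ) * z = ((m : ℝ) : ℂ) * z := by push_cast; ring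
  rw [this, Complex.im_ofReal_mul]
  have : (0:ℝ) < m := by exact_mod_cast Nat.pos_of_ne_zero hm
  positivity

theorem hasSum_UU {A : ℤ⟦X⟧} (hA : Conv (cc A)) {m : ℕ} (hm : m ≠ 0) {z : ℂ} (hz : 0 < z.im) :
    HasSum (fun n => (cc (UU m A)).coeff n * ee z ^ n)
      ((1 / m) * ∑ b ∈ range m, Ev (cc A) (ee ((z + b) / m))) := by
  have h1 : ∀ b ∈ range m, HasSum (fun n => (cc A).coeff n * ee ((z + b) / m) ^ n)
      (Ev (cc A) (ee ((z + b) / m))) := fun b _ => hA.hasSum (ee_norm_lt (by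
        have := im_div_nat hz hm b; simpa using this))
  have h2 := (hasSum_sum h1).mul_left (1 / (m : ℂ))
  have hm' : (m : ℂ) ≠ 0 := by exact_mod_cast hm
  have h3 : ∀ n : ℕ, (1 / (m : ℂ)) * ∑ b ∈ range m, (cc A).coeff n * ee ((z + b) / m) ^ n =
      if m ∣ n then (cc A).coeff n * ee (z / m) ^ n else 0 := fun n => by
    have : ∀ b ∈ range m, (cc A).coeff n * ee ((z + b) / m) ^ n =
        ((cc A).coeff n * ee (z / m) ^ n) * ee ((n : ℤ) * b / m) := fun b _ => by
      rw [mul_assoc, ← ee_nat_mul, ← ee_nat_mul, ← ee_add]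
      congr 2; push_cast; ring
    rw [Finset.sum_congr rfl this, ← Finset.mul_sum, sum_roots hm]
    by_cases h : m ∣ n
    · rw [if_pos h, if_pos (by exact_mod_cast h)]; field_simp
    · rw [if_neg h, if_neg (by exact_mod_cast h)]; simp
  simp_rw [h3] at h2
  have hinj : Function.Injective (fun n : ℕ => m * n) := fun a b h => Nat.eq_of_mul_eq_mul_left (Nat.pos_of_ne_zero hm) h
  rw [← hinj.hasSum_iff (fun n hn => if_neg (fun ⟨k, hk⟩ => hn ⟨k, hk.symm⟩))] at h2
  refine Eq.mp (congrArg (fun f => HasSum f _) (funext fun n => ?_)) h2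
  simp only [Function.comp, dvd_mul_right, if_true]
  rw [← ee_nat_mul, ← ee_nat_mul]
  simp only [UU, coeff_map, coeff_mk]
  congr 2; push_cast; field_simp

theorem Conv_UU {A : ℤ⟦X⟧} (hA : Conv (cc A)) {m : ℕ} (hm : m ≠ 0) : Conv (cc (UU m A)) :=
  Conv.of_H fun _ hz => (hasSum_UU hA hm hz).summable

theorem Ev_UU {A : ℤ⟦X⟧} (hA : Conv (cc A)) {m : ℕ} (hm : m ≠ 0) {z : ℂ} (hz : 0 < z.im) :
    Ev (cc (UU m A)) (ee z) = (1 / m) * ∑ b ∈ range m, Ev (cc A) (ee ((z + b) / m)) :=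
  (hasSum_UU hA hm hz).tsum_eq

theorem hasSum_expand {A : ℤ⟦X⟧} (hA : Conv (cc A)) {m : ℕ} (hm : m ≠ 0) {z : ℂ} (hz : 0 < z.im) :
    HasSum (fun n => (cc (expand m hm A)).coeff n * ee z ^ n) (Ev (cc A) (ee (m * z))) := by
  have h := hA.hasSum (ee_norm_lt (im_nat_mul hz hm))
  have hinj : Function.Injective (fun n : ℕ => m * n) := fun a b h => Nat.eq_of_mul_eq_mul_left (Nat.pos_of_ne_zero hm) h
  rw [← hinj.hasSum_iff (fun n hn => ?_)]
  · convert h using 2 with n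
    simp only [Function.comp, coeff_map, coeff_expand_mul]
    rw [← ee_nat_mul, ← ee_nat_mul]
    congr 2; push_cast; ring
  · rw [coeff_map, coeff_expand_of_not_dvd _ _ _ (fun ⟨k, hk⟩ => hn ⟨k, hk.symm⟩)]; simp

theorem Conv_expand {A : ℤ⟦X⟧} (hA : Conv (cc A)) {m : ℕ} (hm : m ≠ 0) : Conv (cc (expand m hm A)) :=
  Conv.of_H fun _ hz => (hasSum_expand hA hm hz).summable

theorem Ev_expand {A : ℤ⟦X⟧} (hA : Conv (cc A)) {m : ℕ} (hm : m ≠ 0) {z : ℂ} (hz : 0 < z.im) :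
    Ev (cc (expand m hm A)) (ee z) = Ev (cc A) (ee (m * z)) :=
  (hasSum_expand hA hm hz).tsum_eq

/-- prime Hecke operator -/
noncomputable def TT (m w : ℕ) (hm : m ≠ 0) (A : ℤ⟦X⟧) : ℤ⟦X⟧ :=
  UU m A + ((m : ℤ) ^ (w - 1)) • expand m hm A

theorem Ev_congr_mod {A : ℤ⟦X⟧} {m : ℕ} (hm : m ≠ 0) (z : ℂ) (a b : ℤ) (h : (m : ℤ) ∣ a - b) :
    Ev (cc A) (ee ((z + a) / m)) = Ev (cc A) (ee ((z + b) / m)) := by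
  obtain ⟨k, hk⟩ := h
  have : ((z + a) / m) = (z + b) / m + k := by
    have hm' : (m : ℂ) ≠ 0 := by exact_mod_cast hm
    have : (a : ℂ) = b + m * k := by exact_mod_cast (by linarith : a = b + m * k)
    rw [this]; field_simp; ring
  rw [this, ee_add_int]

theorem MF_TT {w : ℕ} (hw : 0 < w) {A : ℤ⟦X⟧} (hA : MF w A) {m : ℕ} (hm : m.Prime) :
    MF w (TT m w hm.ne_zero A) := by
  have : Fact m.Prime := ⟨hm⟩
  have hm0 := hm.ne_zero
  have hm' : (m : ℂ) ≠ 0 := by exact_mod_cast hm0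
  have hc1 := Conv_UU hA.1 hm0
  have hc2 := (Conv_expand hA.1 hm0).zsmul ((m : ℤ) ^ (w - 1))
  refine ⟨by rw [TT, map_add, map_zsmul]; exact hc1.add hc2, ?_⟩
  have hE : ∀ z : ℂ, 0 < z.im → Ev (cc (TT m w hm0 A)) (ee z) =
      (1 / m) * (Ev (cc A) (ee (z / m)) +
        ∑ b ∈ (univ : Finset (ZMod m)).erase 0, Ev (cc A) (ee ((z + (b.val : ℤ)) / m)))
      + m ^ (w - 1) * Ev (cc A) (ee (m * z)) := by
    intro z hz
    rw [TT, map_add, map_zsmul, Ev_add hc1 hc2 (ee_norm_lt hz), Ev_zsmul, Ev_expand hA.1 hm0 hz,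
      Ev_UU hA.1 hm0 hz, ← sum_zmod_val (fun b => Ev (cc A) (ee ((z + b) / m))),
      ← Finset.add_sum_erase _ _ (Finset.mem_univ (0 : ZMod m))]
    simp
  intro z hz
  have hz0 : z ≠ 0 := by rintro rfl; simp at hz
  rw [hE z hz, hE _ (im_S hz)]
  have h1 : Ev (cc A) (ee (-1 / z / m)) = (m * z) ^ w * Ev (cc A) (ee (m * z)) := by
    rw [← hA.2 _ (im_nat_mul hz hm0)]; congr 2; field_simp
  have h2 : z ^ w * Ev (cc A) (ee (z / m)) = m ^ w * Ev (cc A) (ee (m * (-1 / z))) := by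
    have := hA.2 (z / m) (by simpa using im_div_nat hz hm0 0)
    rw [show m * (-1 / z) = -1 / (z / m) by field_simp, this, div_pow]; field_simp
  have h3 : ∑ b ∈ (univ : Finset (ZMod m)).erase 0, Ev (cc A) (ee ((-1 / z + (b.val : ℤ)) / m)) =
      z ^ w * ∑ b ∈ (univ : Finset (ZMod m)).erase 0, Ev (cc A) (ee ((z + (b.val : ℤ)) / m)) := by
    rw [Finset.mul_sum]
    refine Finset.sum_bij' (fun b _ => -b⁻¹) (fun b _ => -b⁻¹) ?_ ?_ ?_ ?_ ?_
    · intro b hb; simpa using hb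
    · intro b hb; simpa using hb
    · intro b hb; simp [inv_neg]
    · intro b hb; simp [inv_neg]
    · intro b hb
      have hb0 : b ≠ 0 := by simpa using hb
      obtain ⟨β, hβ⟩ : (m : ℤ) ∣ -1 - (b.val : ℤ) * ((-b⁻¹ : ZMod m).val : ℤ) := by
        rw [← ZMod.intCast_zmod_eq_zero_iff_dvd]
        push_cast
        simp [hb0]
      have hz' := im_div_nat hz hm0 ((-b⁻¹ : ZMod m).val)
      have := hA.action (b.val) β m (-((-b⁻¹ : ZMod m).val : ℤ)) (by linear_combination hβ) hz'
      have hβ' : (-1 : ℂ) - (b.val : ℂ) * ((-b⁻¹ : ZMod m).val : ℂ) = m * β := by exact_mod_cast hβ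
      generalize ((-b⁻¹ : ZMod m).val) = c at *
      have e1 : ((m : ℤ) : ℂ) * ((z + ((c : ℤ) : ℂ)) / m) + ((-(c : ℤ) : ℤ) : ℂ) = z := by
        push_cast; field_simp; ring
      rw [e1] at this
      rw [← this]
      congr 2
      push_cast
      field_simp
      linear_combination hβ'
  rw [h3]
  have hp : (m : ℂ) ^ w = m * m ^ (w - 1) := by rw [← pow_succ', Nat.sub_add_cancel hw]
  rw [h1, mul_pow]
  have h4 : (m : ℂ) ^ (w - 1) * Ev (cc A) (ee (m * (-1 / z))) = (1 / m) * (z ^ w * Ev (cc A) (ee (z / m))) := by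
    rw [h2, hp]; field_simp
  rw [h4, hp]
  field_simp
  ring

theorem coeff_zs (c : ℤ) (A : ℤ⟦X⟧) (n : ℕ) : (c • A).coeff n = c * A.coeff n := by
  rw [map_zsmul, smul_eq_mul]

noncomputable def EE : ℤ⟦X⟧ := PowerSeries.mk fun n => if n = 0 then 1 else 240 * (ArithmeticFunction.sigma 3 n : ℤ)

open UpperHalfPlane ModularForm MatrixGroups SlashInvariantForm EisensteinSeries in
theorem EE_coeff (n : ℕ) : ((EE.coeff n : ℤ) : ℂ) = (qExpansion 1 E₄).coeff n := by
  rw [E_qExpansion_coeff _ ⟨2, rfl⟩]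
  norm_num [show bernoulli 4 = -1 / 30 by decide +kernel, EE]

open UpperHalfPlane ModularForm MatrixGroups SlashInvariantForm EisensteinSeries in
theorem EE_hasSum (τ : ℍ) : HasSum (fun n => (cc EE).coeff n * ee τ ^ n) (E₄ τ) := by
  have := ModularForm.hasSum_qExpansion (f := E₄) one_pos one_mem_strictPeriods_SL τ
  simp_rw [← EE_coeff] at this
  simpa [ee, Function.Periodic.qParam] using this

open UpperHalfPlane ModularForm MatrixGroups SlashInvariantForm EisensteinSeries in
theorem MF_EE : MF 4 EE := by
  refine ⟨Conv.of_H fun z hz => (EE_hasSum (UpperHalfPlane.mk z hz)).summable, fun z hz => ?_⟩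
  have h1 : Ev (cc EE) (ee z) = E₄ (UpperHalfPlane.mk z hz) := (EE_hasSum (UpperHalfPlane.mk z hz)).tsum_eq
  have h2 : Ev (cc EE) (ee (-1/z)) = E₄ (UpperHalfPlane.mk _ (im_S hz)) :=
    (EE_hasSum (UpperHalfPlane.mk _ (im_S hz))).tsum_eq
  rw [h1, h2]
  have h0 : (E₄ : ℍ → ℂ) ∣[(4 : ℤ)] ModularGroup.S = E₄ := slash_action_eqn E₄ _ ⟨ModularGroup.S, rfl⟩
  have h := congr_fun h0 (UpperHalfPlane.mk z hz)
  rw [SL_slash_apply, ModularGroup.denom_S] at h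
  rw [show (ModularGroup.S • (UpperHalfPlane.mk z hz)) = (UpperHalfPlane.mk _ (im_S hz)) from ?_] at h
  · rw [← h, mul_left_comm]
    have hz0 : z ≠ 0 := by rintro rfl; simp at hz
    have : z ^ 4 * z ^ (-4 : ℤ) = 1 := by
      rw [zpow_neg]; exact mul_inv_cancel₀ (pow_ne_zero 4 hz0)
    change _ = _ * (z ^ 4 * z ^ (-4 : ℤ))
    rw [this, mul_one]
  · ext; rw [UpperHalfPlane.modular_S_smul]; simp [neg_div, inv_neg]

theorem EE_zero : EE.coeff 0 = 1 := by simp [EE]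

theorem TT_iter {w : ℕ} (hw : 0 < w) {Y : ℤ⟦X⟧} (hY : MF w Y) {m : ℕ} (hm : m.Prime) (k : ℕ) (hk : k ≤ w - 1) (j : ℕ) :
    ∃ Z, MF w Z ∧ ((m ^ k : ℕ) : ℤ⟦X⟧) ∣ Z - UU (m ^ j) Y := by
  induction j with
  | zero => exact ⟨Y, hY, by
      have : UU (m ^ 0) Y = Y := by ext n; simp [UU]
      rw [this]; simp⟩
  | succ j ih =>
    obtain ⟨Z, hZ, hd⟩ := ih
    refine ⟨_, MF_TT hw hZ hm, ?_⟩
    have h1 := UU_dvd m _ _ hd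
    have h2 : UU m (UU (m ^ j) Y) = UU (m ^ (j+1)) Y := by
      ext n; simp [UU, pow_succ, mul_assoc]
    rw [UU_sub, h2] at h1
    have h3 : ((m ^ k : ℕ) : ℤ⟦X⟧) ∣ ((m : ℤ) ^ (w - 1)) • expand m hm.ne_zero Z := by
      rw [natCast_dvd_iff]; intro n
      rw [coeff_zs]
      refine Dvd.dvd.mul_right ?_ _
      push_cast
      exact pow_dvd_pow _ hk
    rw [TT, add_sub_right_comm]
    exact dvd_add h1 h3

theorem DDE_coeff (i v : ℕ) (n : ℕ) (hn : n ≤ i) : (DD ^ i * EE ^ v).coeff n = if n = i then 1 else 0 := by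
  rw [DD, mul_pow, mul_assoc, coeff_X_pow_mul']
  split_ifs with h1 h2 h3
  · subst h2
    simp only [Nat.sub_self, coeff_zero_eq_constantCoeff, map_mul, map_pow]
    simp only [← coeff_zero_eq_constantCoeff_apply, PP_coeff_zero, EE_zero]; simp
  · omega
  · omega
  · rfl

theorem clear_low {b N : ℕ} {Y : ℤ⟦X⟧} (hY : MF (12 * b) Y) (e : ℕ) (he : e ≤ b)
    (h : ∀ i < e, (N : ℤ) ∣ Y.coeff i) :
    ∃ Z, MF (12 * b) Z ∧ (N : ℤ⟦X⟧) ∣ Z - Y ∧ ∀ i < e, Z.coeff i = 0 := by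
  induction e with
  | zero => exact ⟨Y, hY, by simp, by simp⟩
  | succ e ih =>
    obtain ⟨Z, hZ, hd, h0⟩ := ih (by omega) (fun i hi => h i (by omega))
    have hm : MF (12 * b) (DD ^ e * EE ^ (3 * (b - e))) := by
      have := (MF_DD.pow e).mul (MF_EE.pow (3 * (b - e)))
      rwa [show 12 * e + 4 * (3 * (b - e)) = 12 * b by omega] at this
    have hd' := (natCast_dvd_iff _ _).mp hd
    have hc : (N : ℤ) ∣ Z.coeff e := by
      have := dvd_add (hd' e) (h e (by omega)); simpa using this
    refine ⟨Z - (Z.coeff e) • (DD ^ e * EE ^ (3 * (b - e))), hZ.sub (hm.zsmul _), ?_, ?_⟩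
    · rw [natCast_dvd_iff]; intro n
      have h1 := hd' n
      have : (Z - (Z.coeff e) • (DD ^ e * EE ^ (3 * (b - e))) - Y).coeff n =
        (Z - Y).coeff n - Z.coeff e * (DD ^ e * EE ^ (3 * (b - e))).coeff n := by
          simp only [map_sub, coeff_zs]; ring
      rw [this]
      exact dvd_sub h1 (hc.mul_right _)
    · intro i hi
      rw [map_sub, coeff_zs, DDE_coeff _ _ _ (by omega)]
      split_ifs with h1
      · subst h1; simp
      · rw [h0 i (by omega)]; simp

theorem Conv.of_X_pow_mul {A : ℂ⟦X⟧} {e : ℕ} (h : Conv (X ^ e * A)) : Conv A := by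
  refine Conv.of_H fun z hz => ?_
  have h1 := (h (ee z) (ee_norm_lt hz)).of_norm
  have h2 := ((summable_nat_add_iff e).mpr h1).mul_left ((ee z ^ e)⁻¹)
  refine h2.congr fun n => ?_
  rw [coeff_X_pow_mul]
  have := pow_ne_zero e (ee_ne_zero z)
  rw [pow_add]; field_simp

theorem exists_f {b N e : ℕ} {Y : ℤ⟦X⟧} (hY : MF (12 * b) Y) (he : e ≤ b)
    (h : ∀ i < e, (N : ℤ) ∣ Y.coeff i) :
    ∃ f, MF (12 * (b - e)) f ∧ (N : ℤ⟦X⟧) ∣ f * DD ^ e - Y := by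
  obtain ⟨Z, hZ, hd, h0⟩ := clear_low hY e he h
  obtain ⟨A, rfl⟩ := X_pow_dvd_iff.mpr h0
  obtain ⟨Q, hQ, hQc⟩ := exists_PP_inv
  have hf : (A * Q ^ (24 * e)) * DD ^ e = X ^ e * A := by
    calc _ = X ^ e * A * (PP * Q) ^ (24 * e) := by rw [DD]; ring
      _ = _ := by rw [hQ]; ring
  have hAc : Conv (cc A) := by
    have := hZ.1
    rw [map_mul, map_pow, PowerSeries.map_X] at this
    exact this.of_X_pow_mul
  have hfc : Conv (cc (A * Q ^ (24 * e))) := by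
    rw [map_mul, map_pow]; exact hAc.mul (hQc.pow _)
  refine ⟨A * Q ^ (24 * e), ⟨hfc, fun z hz => ?_⟩, by rwa [hf]⟩
  have key : ∀ z : ℂ, 0 < z.im → Ev (cc (A * Q ^ (24 * e))) (ee z) * (Ev (cc DD) (ee z)) ^ e =
      Ev (cc (X ^ e * A)) (ee z) := fun z hz => by
    rw [← hf, map_mul cc _ (DD ^ e), map_pow cc DD, Ev_mul hfc (Conv_DD.pow e) (ee_norm_lt hz), Ev_pow Conv_DD _ (ee_norm_lt hz)]
  have hz0 : z ≠ 0 := by rintro rfl; simp at hz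
  have h3 := hZ.2 z hz
  rw [← key z hz, ← key _ (im_S hz), MF_DD.2 z hz] at h3
  have hD0 : Ev (cc DD) (ee z) ≠ 0 := by
    rw [Ev_DD (ee_norm_lt hz)]
    exact mul_ne_zero (ee_ne_zero z) (pow_ne_zero _ (Ev_PP_ne_zero (ee_norm_lt hz)))
  have h4 : (z ^ 12 * Ev (cc DD) (ee z)) ^ e ≠ 0 := pow_ne_zero _ (mul_ne_zero (pow_ne_zero _ hz0) hD0)
  apply mul_right_cancel₀ h4
  rw [h3, show 12 * b = 12 * (b - e) + 12 * e by omega]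
  rw [pow_add, mul_pow]; ring

/-- The reduction to integral modular forms. -/
theorem exists_main (m k r : ℕ) (hm : m.Prime) (hm5 : 5 ≤ m) (hk : 0 < k) (hr : 0 < r) (hrodd : Odd r)
    (hrm : r < m ^ k) : ∃ w r' : ℕ, ∃ f : ℤ⟦X⟧, 0 < w ∧ Even w ∧ Odd r' ∧ r' < 24 ∧ MF w f ∧ 24 ∣ m ^ k * r' + r ∧
      ∀ j, ((m ^ k : ℕ) : ℤ) ∣ (f * PP ^ r').coeff j - multipartition r ((m ^ k * (24 * j + r') + r) / 24) := by
  have hm2 : m ^ 2 % 24 = 1 := by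
    have h2 : m % 2 ≠ 0 := fun h => by
      have := (Nat.prime_dvd_prime_iff_eq Nat.prime_two hm).mp (Nat.dvd_of_mod_eq_zero h); omega
    have h3 : m % 3 ≠ 0 := fun h => by
      have := (Nat.prime_dvd_prime_iff_eq Nat.prime_three hm).mp (Nat.dvd_of_mod_eq_zero h); omega
    have h4 : m % 24 < 24 := Nat.mod_lt _ (by norm_num)
    have h5 : m % 24 % 2 ≠ 0 := by omega
    have h6 : m % 24 % 3 ≠ 0 := by omega
    rw [Nat.pow_mod]
    generalize m % 24 = x at *
    interval_cases x <;> simp_all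
  have hm2' : m ^ 2 ≡ 1 [MOD 24] := hm2
  obtain ⟨t, rfl⟩ : ∃ t, k = t + 1 := ⟨k - 1, by omega⟩
  set c := m * r + 24 * (m * r + t + 1) with hc
  have hmodd : Odd m := hm.odd_of_ne_two (by omega)
  have hcm : c ≡ m * r [MOD 24] := by simp [hc, Nat.ModEq]
  have hmm : ∀ t, m ^ (2 * t) ≡ 1 [MOD 24] := fun t => by
    rw [pow_mul]; simpa using hm2'.pow t
  have hpow : m ^ (2 * (t + 1) - 1) * c ≡ r [MOD 24] := by
    calc m ^ (2 * (t + 1) - 1) * c ≡ m ^ (2 * (t + 1) - 1) * (m * r) [MOD 24] := hcm.mul_left _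
      _ = m ^ (2 * (t + 1)) * r := by
        rw [show 2 * (t + 1) = 2 * (t + 1) - 1 + 1 by omega, pow_succ, Nat.add_sub_cancel]; ring
      _ ≡ 1 * r [MOD 24] := (hmm _).mul_right _
      _ = r := one_mul r
  have hpow1 : 1 ≤ m ^ (2 * (t + 1) - 1) := Nat.one_le_pow _ _ hm.pos
  have hlt : r ≤ m ^ (2 * (t + 1) - 1) * c := by
    have : r ≤ c := by nlinarith [hm.pos]
    nlinarith
  obtain ⟨b, hb⟩ := (Nat.modEq_iff_dvd' hlt).mp hpow.symm
  have hb' : m ^ (2 * (t + 1) - 1) * c = 24 * b + r := by omega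
  set C := m ^ t * c with hC
  have hCodd : Odd C := by
    refine (hmodd.pow).mul ?_
    rw [hc]; exact (hmodd.mul hrodd).add_even ((by decide : Even 24).mul_right _)
  obtain ⟨r', hr'1, e, hr'2⟩ : ∃ r', r' < 24 ∧ ∃ e, C + r' = 24 * e := ⟨(24 - C % 24) % 24, by omega, (C + (24 - C % 24) % 24) / 24, by omega⟩
  have hr'odd : Odd r' := by
    rw [Nat.odd_iff] at hCodd ⊢; omega
  have hmC : m ^ (2 * (t + 1) - 1) * c = m ^ (t + 1) * C := by
    rw [hC, ← mul_assoc, ← pow_add]; congr 2; omega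
  have hcbig : 24 * (r + t + 1) ≤ c := by nlinarith [hm.pos]
  have hCc : c ≤ C := Nat.le_mul_of_pos_left _ (pow_pos hm.pos _)
  have hm5' : 5 * C ≤ m ^ (t + 1) * C := by
    refine Nat.mul_le_mul_right _ ?_
    calc 5 ≤ m := hm5
      _ ≤ m ^ (t + 1) := Nat.le_self_pow (by omega) m
  have heb : e + t + 2 ≤ b := by omega
  have hk1 : t + 1 ≤ 12 * b - 1 := by omega
  obtain ⟨Y, hY, hYd⟩ := TT_iter (w := 12 * b) (by omega) (MF_DD.pow b) hm (t + 1) hk1 (t + 1)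
  have hlow : ∀ i < e, ((m ^ (t + 1) : ℕ) : ℤ) ∣ Y.coeff i := fun i hi => by
    have h1 := coeff_low m (t + 1) r c b C r' e hm (by omega) hrm hb' hC hr'1 hr'2 i hi
    have h2 := (natCast_dvd_iff _ _).mp hYd i
    have := dvd_add h2 h1; simpa using this
  obtain ⟨f, hf, hfd⟩ := exists_f hY (by omega) hlow
  refine ⟨12 * (b - e), r', f, by omega, (by decide : Even 12).mul_right _, hr'odd, hr'1, hf, ?_, ?_⟩
  · have : m ^ (t + 1) * r' + r + 24 * b = 24 * (m ^ (t + 1) * e) := by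
      calc _ = m ^ (t + 1) * r' + (24 * b + r) := by ring
        _ = m ^ (t + 1) * (C + r') := by rw [← hb', hmC]; ring
        _ = _ := by rw [hr'2]; ring
    omega
  · refine coeff_main m (t + 1) r c b C r' e hm (by omega) hb' hC hr'2 f ?_
    have := dvd_add hfd hYd
    simpa using this

noncomputable def ss (z : ℂ) : ℂ := (-Complex.I * z) ^ (1 / 2 : ℂ)

theorem ss_ne_zero {z : ℂ} (hz : z ≠ 0) : ss z ≠ 0 := by
  rw [ss, Complex.cpow_ne_zero_iff]; left; simpa using hz

theorem ss_mul {z : ℂ} (hz : z ≠ 0) {N : ℕ} (hN : N ≠ 0) : ss (N * z) = (Real.sqrt N : ℂ) * ss z := by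
  have hN' : (0:ℝ) < N := by exact_mod_cast Nat.pos_of_ne_zero hN
  have h0 : -Complex.I * z ≠ 0 := by simpa using hz
  have hN0 : ((N : ℝ) : ℂ) ≠ 0 := by exact_mod_cast hN
  rw [ss, ss, show -Complex.I * (N * z) = ((N : ℝ) : ℂ) * (-Complex.I * z) by push_cast; ring,
    Complex.cpow_def_of_ne_zero (mul_ne_zero hN0 h0), Complex.cpow_def_of_ne_zero h0,
    Complex.log_ofReal_mul hN' h0, add_mul, Complex.exp_add]
  congr 1
  rw [Real.sqrt_eq_rpow, Real.rpow_def_of_pos hN']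
  push_cast; rfl

theorem hasSum_residues {N : ℕ} (hN : N ≠ 0) {F : ℤ → ℂ} {S : ℕ → ℂ}
    (h : ∀ a ∈ range N, HasSum (fun t : ℤ => F (a + N * t)) (S a)) : HasSum F (∑ a ∈ range N, S a) := by
  have hN' : (N : ℤ) ≠ 0 := by exact_mod_cast hN
  have h1 : ∀ a ∈ range N, HasSum (fun n : ℤ => if n % N = a then F n else 0) (S a) := fun a ha => by
    have hinj : Function.Injective (fun t : ℤ => (a : ℤ) + N * t) := fun x y hxy => by
      simpa [hN] using hxy
    rw [← hinj.hasSum_iff]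
    · refine Eq.mp (congrArg (fun f => HasSum f _) (funext fun t => ?_)) (h a ha)
      have : ((a : ℤ) + N * t) % N = a := by
        rw [Int.add_mul_emod_self_left]
        exact Int.emod_eq_of_lt (by positivity) (by exact_mod_cast mem_range.mp ha)
      simp [Function.comp, this]
    · intro n hn
      rw [if_neg]
      intro h
      apply hn
      refine ⟨n / N, ?_⟩
      simp only
      rw [← h, Int.emod_add_mul_ediv]
  refine Eq.mp (congrArg (fun f => HasSum f _) (funext fun n => ?_)) (hasSum_sum h1)
  have h2 : n % N = ((n % N).toNat : ℤ) := (Int.toNat_of_nonneg (Int.emod_nonneg _ hN')).symm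
  rw [Finset.sum_eq_single (n % N).toNat]
  · rw [if_pos h2]
  · intro b _ hb
    rw [if_neg]; intro h; apply hb; omega
  · intro h
    exfalso; apply h; rw [mem_range]
    have := Int.emod_lt_of_pos n (show (0:ℤ) < N by omega)
    omega

theorem theta_transform {N : ℕ} (hN : N ≠ 0) (φ : ℤ → ℂ) (hφ : ∀ a t : ℤ, φ (a + N * t) = φ a)
    {τ : ℂ} (hτ : 0 < τ.im) : ∃ S : ℂ,
      HasSum (fun n : ℤ => φ n * ee (n ^ 2 * τ / (2 * N))) S ∧
      HasSum (fun k : ℤ => (∑ a ∈ range N, φ a * ee (k * a / N)) * ee (k ^ 2 * (-1 / τ) / (2 * N)))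
        (ss (N * τ) * S) := by
  have hN' : (N : ℂ) ≠ 0 := by exact_mod_cast hN
  have hτ0 : τ ≠ 0 := by rintro rfl; simp at hτ
  have hNτ : 0 < (N * τ).im := im_nat_mul hτ hN
  refine ⟨∑ a ∈ range N, φ a * (ee (a ^ 2 * τ / (2 * N)) * jacobiTheta₂ (a * τ) (N * τ)), ?_, ?_⟩
  · refine hasSum_residues hN fun a _ => ?_
    have h := ((hasSum_jacobiTheta₂_term (a * τ) hNτ).mul_left (ee (a ^ 2 * τ / (2 * N)))).mul_left (φ a)
    refine Eq.mp (congrArg (fun f => HasSum f _) (funext fun t => ?_)) h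
    rw [hφ]
    congr 1
    rw [jacobiTheta₂_term, ee, ee, ← Complex.exp_add]
    congr 1
    push_cast
    field_simp
    ring
  · rw [Finset.mul_sum]
    have h1 : ∀ a ∈ range N, HasSum (fun k : ℤ => φ a * ee (k * a / N) * ee (k ^ 2 * (-1 / τ) / (2 * N)))
        (ss (N * τ) * (φ a * (ee (a ^ 2 * τ / (2 * N)) * jacobiTheta₂ (a * τ) (N * τ)))) := fun a _ => by
      have hS : 0 < (-1 / (N * τ)).im := im_S hNτ
      have h := ((hasSum_jacobiTheta₂_term (a / N : ℂ) hS)).mul_left (φ a)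
      have h2 : ss (N * τ) * (φ a * (ee (a ^ 2 * τ / (2 * N)) * jacobiTheta₂ (a * τ) (N * τ))) =
          φ a * jacobiTheta₂ (a / N) (-1 / (N * τ)) := by
        rw [jacobiTheta₂_functional_equation (a * τ) (N * τ)]
        have h3 := ss_ne_zero (mul_ne_zero hN' hτ0)
        have h4 : ee (a ^ 2 * τ / (2 * N)) * Complex.exp (-Real.pi * Complex.I * (a * τ) ^ 2 / (N * τ)) = 1 := by
          rw [ee, ← Complex.exp_add, ← Complex.exp_zero]; congr 1; field_simp; ring
        have h5 : (a * τ) / (N * τ) = a / N := by field_simp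
        rw [h5, ← ss]
        calc _ = (ss (N * τ) * (1 / ss (N * τ))) * (ee (a ^ 2 * τ / (2 * N)) * Complex.exp (-Real.pi * Complex.I * (a * τ) ^ 2 / (N * τ))) * (φ a * jacobiTheta₂ (a / N) (-1 / (N * τ))) := by ring
          _ = _ := by rw [h4, mul_one_div_cancel h3]; ring
      rw [h2]
      refine Eq.mp (congrArg (fun f => HasSum f _) (funext fun k => ?_)) h
      rw [mul_assoc]; congr 1
      rw [jacobiTheta₂_term, ee, ee, ← Complex.exp_add]
      congr 1
      field_simp
    refine Eq.mp (congrArg (fun f => HasSum f _) (funext fun k => ?_)) (hasSum_sum h1)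
    rw [Finset.sum_mul]

def chi12 (x : ZMod 12) : ℤ := if x = 1 ∨ x = 11 then 1 else if x = 5 ∨ x = 7 then -1 else 0
def chi (n : ℤ) : ℤ := chi12 (n : ZMod 12)

theorem chi12_mul : ∀ x y : ZMod 12, chi12 (x * y) = chi12 x * chi12 y := by decide
theorem chi_mul (a b : ℤ) : chi (a * b) = chi a * chi b := by
  rw [chi, chi, chi, Int.cast_mul, chi12_mul]
theorem chi_congr {a b : ℤ} (h : (12 : ℤ) ∣ a - b) : chi a = chi b := by
  rw [chi, chi]; congr 1
  rw [← sub_eq_zero, ← Int.cast_sub]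
  exact (ZMod.intCast_zmod_eq_zero_iff_dvd _ 12).mpr (by exact_mod_cast h)
theorem chi_emod (n : ℤ) : chi n = chi (n % 12) := chi_congr (by omega)
theorem chi_neg (n : ℤ) : chi (-n) = chi n := by
  have : chi (-1) = 1 := by decide
  rw [show -n = (-1) * n by ring, chi_mul, this, one_mul]

noncomputable def et (z : ℂ) : ℂ := ee (z / 24) * Ev (cc PP) (ee z)

theorem et_ne_zero {z : ℂ} (hz : 0 < z.im) : et z ≠ 0 :=
  mul_ne_zero (ee_ne_zero _) (Ev_PP_ne_zero (ee_norm_lt hz))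

theorem chi_six (k : ℤ) : chi (6 * k - 1) = (Int.negOnePow k : ℤ) := by
  rcases Int.even_or_odd k with h | h
  · rw [Int.negOnePow_even k h]
    obtain ⟨j, rfl⟩ := h
    rw [chi_congr (b := -1) ⟨j, by ring⟩]; decide
  · rw [Int.negOnePow_odd k h]
    obtain ⟨j, rfl⟩ := h
    rw [chi_congr (b := 5) ⟨j, by ring⟩]; decide

theorem et_hasSum_half {z : ℂ} (hz : 0 < z.im) :
    HasSum (fun k : ℤ => (chi (6 * k - 1) : ℂ) * ee ((6 * k - 1) ^ 2 * z / 24)) (et z) := by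
  have h := (hasSum_PP_int (ee_norm_lt hz)).mul_left (ee (z / 24))
  refine Eq.mp (congrArg (fun f => HasSum f _) (funext fun k => ?_)) h
  rw [chi_six, mul_left_comm, ← ee_nat_mul, ← ee_add]
  congr 2
  have h2 : ((2 * (pentagonal k : ℤ) : ℤ) : ℂ) = ((k * (3 * k - 1) : ℤ) : ℂ) := by
    rw [two_mul_natCast_pentagonal]
  push_cast at h2
  linear_combination (z / 2) * h2

theorem et_hasSum {z : ℂ} (hz : 0 < z.im) :
    HasSum (fun n : ℤ => (chi n : ℂ) * ee (n ^ 2 * z / 24)) (2 * et z) := by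
  set f : ℤ → ℂ := fun n : ℤ => (chi n : ℂ) * ee (n ^ 2 * z / 24) with hf
  have h1 := et_hasSum_half hz
  have a1 : HasSum (fun n => if n % 6 = 5 then f n else 0) (et z) := by
    have hinj : Function.Injective (fun t : ℤ => 6 * t - 1) := fun x y hxy => by
      simp at hxy; omega
    rw [← hinj.hasSum_iff]
    · refine Eq.mp (congrArg (fun f => HasSum f _) (funext fun t => ?_)) h1
      have : (6 * t - 1) % 6 = 5 := by omega
      simp [Function.comp, this, hf]
    · intro n hn
      rw [if_neg]; intro h; exact hn ⟨n / 6 + 1, by simp only; omega⟩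
  have a2 : HasSum (fun n => if n % 6 = 1 then f n else 0) (et z) := by
    have hinj : Function.Injective (fun t : ℤ => 1 - 6 * t) := fun x y hxy => by
      simp at hxy; omega
    rw [← hinj.hasSum_iff]
    · refine Eq.mp (congrArg (fun f => HasSum f _) (funext fun t => ?_)) h1
      have h6 : (1 - 6 * t) % 6 = 1 := by omega
      have h7 : chi (1 - 6 * t) = chi (6 * t - 1) := by rw [← chi_neg]; congr 1; ring
      simp only [Function.comp, h6, hf, h7, if_true]
      congr 2; push_cast; ring
    · intro n hn
      rw [if_neg]; intro h; exact hn ⟨- (n / 6), by simp only; omega⟩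
  rw [two_mul]
  refine Eq.mp (congrArg (fun f => HasSum f _) (funext fun n => ?_)) (a1.add a2)
  by_cases h5 : n % 6 = 5
  · rw [if_pos h5, if_neg (by omega), add_zero]
  · by_cases h6 : n % 6 = 1
    · rw [if_neg h5, if_pos h6, zero_add]
    · rw [if_neg h5, if_neg h6, hf]
      have : chi n = 0 := by
        have e : n % 12 = 0 ∨ n % 12 = 2 ∨ n % 12 = 3 ∨ n % 12 = 4 ∨ n % 12 = 6 ∨ n % 12 = 8 ∨ n % 12 = 9 ∨ n % 12 = 10 := by omega
        rw [chi_emod]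
        rcases e with e | e | e | e | e | e | e | e <;> rw [e] <;> decide
      simp [this]

theorem sum_res {ι : Type*} (s : Finset ι) {N : ℕ} (hN : N ≠ 0) (F : ℤ → ℂ) (hF : ∀ a b : ℤ, (N : ℤ) ∣ a - b → F a = F b)
    (i : ι → ℤ) (hc : s.card = N) (hi : ∀ x ∈ s, ∀ y ∈ s, (N : ℤ) ∣ i x - i y → x = y) :
    ∑ x ∈ s, F (i x) = ∑ n ∈ range N, F n := by
  have hN' : (0 : ℤ) < N := by omega
  have hnn : ∀ x, 0 ≤ i x % N := fun x => Int.emod_nonneg _ hN'.ne'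
  have hm : Set.MapsTo (fun x => (i x % N).toNat) s (range N : Finset ℕ) := fun x _ => by
    have := Int.emod_lt_of_pos (i x) hN'
    have := hnn x
    simp only [coe_range, Set.mem_Iio]; omega
  have hinj : Set.InjOn (fun x => (i x % N).toNat) s := fun x hx y hy h => by
    apply hi x hx y hy
    simp only at h
    have := hnn x
    have := hnn y
    exact Int.ModEq.dvd (n := N) (show i y % N = i x % N by omega)
  have hs := Finset.surjOn_of_injOn_of_card_le _ hm hinj (by simp [hc])
  refine Finset.sum_bij (fun x _ => (i x % N).toNat) (fun x hx => hm hx) (fun x hx y hy h => hinj hx hy h) ?_ ?_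
  · intro b hb
    obtain ⟨a, ha, h⟩ := hs (by simpa using hb)
    exact ⟨a, ha, h⟩
  · intro x _
    apply hF
    rw [Int.toNat_of_nonneg (hnn x)]
    exact Int.dvd_self_sub_emod

theorem ee_congr {N : ℕ} (hN : N ≠ 0) {a b : ℤ} (h : (N : ℤ) ∣ a - b) : ee (a / N) = ee (b / N) := by
  obtain ⟨t, ht⟩ := h
  have hN' : (N : ℂ) ≠ 0 := by exact_mod_cast hN
  have : (a : ℂ) = b + N * t := by
    have : a = b + N * t := by omega
    rw [this]; push_cast; ring
  rw [← ee_add_int (b / N) t, this]; congr 1; field_simp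

theorem gauss12 (k : ℤ) : ∑ y ∈ range 12, (chi y : ℂ) * ee (k * y / 12) = (Real.sqrt 12 : ℂ) * chi k := by
  set w := ee (1 / 12) with hw
  have hw6 : w ^ 6 = -1 := by
    rw [hw, ← ee_nat_mul, ee]
    rw [show (2 * Real.pi * Complex.I * ((6 : ℕ) * (1 / 12))) = Real.pi * Complex.I by push_cast; ring, Complex.exp_pi_mul_I]
  have hwv : w = (Real.sqrt 3 + Complex.I) / 2 := by
    rw [hw, ee, show 2 * Real.pi * Complex.I * (1 / 12) = ((Real.pi / 6 : ℝ) : ℂ) * Complex.I by push_cast; ring,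
      Complex.exp_mul_I, ← Complex.ofReal_cos, ← Complex.ofReal_sin, Real.cos_pi_div_six, Real.sin_pi_div_six]
    push_cast; ring
  have h3 : (Real.sqrt 3 : ℂ) ^ 2 = 3 := by
    rw [← Complex.ofReal_pow, Real.sq_sqrt (by norm_num)]; norm_num
  have h12 : (Real.sqrt 12 : ℂ) = 2 * Real.sqrt 3 := by
    rw [show (12:ℝ) = 2 ^ 2 * 3 by norm_num, Real.sqrt_mul (by norm_num), Real.sqrt_sq (by norm_num)]; push_cast; rfl
  have hw4 : w ^ 4 = w ^ 2 - 1 := by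
    have hI := Complex.I_sq
    have e2 : w ^ 2 = (1 + Real.sqrt 3 * Complex.I) / 2 := by
      rw [hwv]; linear_combination (1/4) * h3 + (1/4) * hI
    have : w ^ 4 = (w ^ 2) ^ 2 := by ring
    rw [this, e2]; linear_combination (Complex.I ^ 2 / 4) * h3 + (3/4) * hI
  have hG : (Real.sqrt 12 : ℂ) = 2 * (2 * w - w ^ 3) := by
    have e3 : w ^ 3 = Complex.I := by
      rw [hw, ← ee_nat_mul, ee]
      rw [show (2 * Real.pi * Complex.I * ((3 : ℕ) * (1 / 12))) = Real.pi / 2 * Complex.I by push_cast; ring, Complex.exp_pi_div_two_mul_I]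
    rw [e3, h12, hwv]; ring
  have hk : ∀ y : ℕ, ee (k * y / 12) = w ^ ((k % 12).toNat * y) := fun y => by
    rw [hw, ← ee_nat_mul]
    have h1 : (((k % 12).toNat : ℕ) : ℤ) = k % 12 := Int.toNat_of_nonneg (by omega)
    have h2 : (12 : ℤ) ∣ k * y - (((k % 12).toNat * y : ℕ) : ℤ) := by
      push_cast; rw [h1, ← sub_mul]; exact Dvd.dvd.mul_right Int.dvd_self_sub_emod _
    have := ee_congr (N := 12) (by norm_num) (by exact_mod_cast h2)
    push_cast at this ⊢
    rw [this]; congr 1; ring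
  simp_rw [hk]
  rw [chi_emod k, hG]
  have h1 : (((k % 12).toNat : ℕ) : ℤ) = k % 12 := Int.toNat_of_nonneg (by omega)
  rw [← h1]
  have hlt : (k % 12).toNat < 12 := by omega
  generalize (k % 12).toNat = x at *
  have c0 : chi 0 = 0 := by decide
  have c1 : chi 1 = 1 := by decide
  have c2 : chi 2 = 0 := by decide
  have c3 : chi 3 = 0 := by decide
  have c4 : chi 4 = 0 := by decide
  have c5 : chi 5 = -1 := by decide
  have c6 : chi 6 = 0 := by decide
  have c7 : chi 7 = -1 := by decide
  have c8 : chi 8 = 0 := by decide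
  have c9 : chi 9 = 0 := by decide
  have c10 : chi 10 = 0 := by decide
  have c11 : chi 11 = 1 := by decide
  have hred : ∀ q r, w ^ (6 * q + r) = (-1) ^ q * w ^ r := fun q r => by rw [pow_add, pow_mul, hw6]
  have hsum : ∑ y ∈ range 12, (chi y : ℂ) * w ^ (x * y) = w ^ x - w ^ (x * 5) - w ^ (x * 7) + w ^ (x * 11) := by
    simp only [Finset.sum_range_succ, Finset.sum_range_zero]
    push_cast
    simp only [c0, c1, c2, c3, c4, c5, c6, c7, c8, c9, c10, c11]
    push_cast; ring
  simp only [Int.toNat_natCast]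
  rw [hsum]
  have hmod : ∀ n, w ^ n = (-1) ^ (n / 6) * w ^ (n % 6) := fun n => by
    rw [← hred, Nat.div_add_mod]
  rw [hmod x, hmod (x * 5), hmod (x * 7), hmod (x * 11)]
  have hw5 : w ^ 5 = w ^ 3 - w := by
    calc w ^ 5 = w * w ^ 4 := by ring
      _ = _ := by rw [hw4]; ring
  interval_cases x <;> simp [c0, c1, c2, c3, c4, c5, c6, c7, c8, c9, c10, c11, hw4, hw5] <;> ring

theorem ee_std {N : ℕ} [NeZero N] (a : ℤ) : ee (a / N) = ZMod.stdAddChar (a : ZMod N) := by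
  rw [ZMod.stdAddChar_coe, ee]; congr 1; ring

/-- quadratic exponential sum -/
noncomputable def Gq (c : ℤ) (N : ℕ) : ℂ := ∑ x ∈ range N, ee (((c * (x : ℤ) ^ 2 : ℤ) : ℂ) / N)

theorem sum_shift {N : ℕ} (hN : N ≠ 0) (F : ℤ → ℂ) (hF : ∀ a b : ℤ, (N : ℤ) ∣ a - b → F a = F b) (t : ℤ) :
    ∑ x ∈ range N, F (x + t) = ∑ x ∈ range N, F x := by
  refine sum_res (range N) hN F hF (fun x => x + t) (by simp) ?_
  intro x hx y hy h
  have h1 : (N : ℤ) ∣ (x : ℤ) - y := by simpa using h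
  rw [mem_range] at hx hy
  have := Int.emod_emod_of_dvd
  have h2 := (Int.emod_emod_of_dvd (x:ℤ) (dvd_refl (N:ℤ)))
  have h3 : (x : ℤ) ≡ y [ZMOD N] := (Int.modEq_iff_dvd.mpr (by rw [← neg_sub]; exact h1.neg_right))
  have h4 := Int.natCast_modEq_iff.mp h3
  exact Nat.ModEq.eq_of_lt_of_lt h4 hx hy

theorem Gq_complete {N : ℕ} (hN : N ≠ 0) (b b' k : ℤ) (h : (N : ℤ) ∣ 576 * b * b' + 1) :
    ∑ x ∈ range N, ee (((144 * b' * (x : ℤ) ^ 2 + x * k : ℤ) : ℂ) / N) =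
      ee (((b * k ^ 2 : ℤ) : ℂ) / N) * Gq (144 * b') N := by
  rw [Gq]
  have h1 := sum_shift hN (fun n : ℤ => ee (((144 * b' * n ^ 2 : ℤ) : ℂ) / N)) (fun a c hac => by
    apply ee_congr hN
    rw [← mul_sub]; exact Dvd.dvd.mul_left (hac.trans (sub_dvd_pow_sub_pow a c 2)) _) (-2 * b * k)
  rw [← h1, Finset.mul_sum]
  refine Finset.sum_congr rfl fun x _ => ?_
  rw [← ee_add, ← add_div, ← Int.cast_add]
  apply ee_congr hN
  obtain ⟨t, ht⟩ := h
  exact ⟨(x * k - b * k ^ 2) * t, by linear_combination (x * k - b * k ^ 2) * ht⟩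

theorem sum_dig {l : ℕ} (hl : l ≠ 0) (F : ℤ → ℂ) (hF : ∀ a b : ℤ, ((l ^ 2 : ℕ) : ℤ) ∣ a - b → F a = F b) :
    ∑ n ∈ range (l ^ 2), F n = ∑ x ∈ range l, ∑ t ∈ range l, F (x + l * t) := by
  rw [← Finset.sum_product', ← sum_res (range l ×ˢ range l) (pow_ne_zero 2 hl) F hF (fun p => p.1 + l * p.2)]
  · simp [sq]
  · rintro ⟨x, t⟩ h1 ⟨y, u⟩ h2 ⟨v, hv⟩
    simp only [mem_product, mem_range] at h1 h2 hv ⊢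
    push_cast at hv
    have h3 : (x : ℤ) ≡ y [ZMOD l] := (Int.modEq_iff_dvd.mpr ⟨t - u - l * v, by linear_combination -hv⟩)
    have hxy := Nat.ModEq.eq_of_lt_of_lt (Int.natCast_modEq_iff.mp h3) h1.1 h2.1
    subst hxy
    have hl' : (l : ℤ) ≠ 0 := by exact_mod_cast hl
    have h5 : (t : ℤ) - u = l * v := mul_left_cancel₀ hl' (by linear_combination hv)
    have h3 : (t : ℤ) ≡ u [ZMOD l] := (Int.modEq_iff_dvd.mpr ⟨-v, by linear_combination -h5⟩)
    have := Nat.ModEq.eq_of_lt_of_lt (Int.natCast_modEq_iff.mp h3) h1.2 h2.2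
    simp [this]

theorem Gq_sq {l : ℕ} (hl : l.Prime) (c : ℤ) (hc : ¬ (l : ℤ) ∣ 2 * c) : Gq c (l ^ 2) = l := by
  have hl0 := hl.ne_zero
  have hlC : (l : ℂ) ≠ 0 := by exact_mod_cast hl0
  rw [Gq, sum_dig hl0 (fun n : ℤ => ee (((c * n ^ 2 : ℤ) : ℂ) / (l ^ 2 : ℕ))) (fun a b h => by
    apply ee_congr (pow_ne_zero 2 hl0)
    rw [← mul_sub]; exact Dvd.dvd.mul_left (h.trans (sub_dvd_pow_sub_pow a b 2)) _)]
  have h1 : ∀ x ∈ range l, ∑ t ∈ range l, ee (((c * ((x : ℤ) + l * t) ^ 2 : ℤ) : ℂ) / (l ^ 2 : ℕ)) =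
      if x = 0 then (l : ℂ) else 0 := fun x hx => by
    have h2 : ∀ t ∈ range l, ee (((c * ((x : ℤ) + l * (t : ℕ)) ^ 2 : ℤ) : ℂ) / (l ^ 2 : ℕ)) =
        ee (((c * (x : ℤ) ^ 2 : ℤ) : ℂ) / (l ^ 2 : ℕ)) * ee (((2 * c * x : ℤ) : ℂ) * t / l) := fun t _ => by
      rw [← ee_add, ← ee_add_int (((c * (x : ℤ) ^ 2 : ℤ) : ℂ) / (l ^ 2 : ℕ) + ((2 * c * x : ℤ) : ℂ) * t / l) (c * t ^ 2)]
      congr 1; push_cast; field_simp; ring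
    rw [Finset.sum_congr rfl h2, ← Finset.mul_sum, sum_roots hl0]
    have hp : Prime (l : ℤ) := Nat.prime_iff_prime_int.mp hl
    by_cases hx0 : x = 0
    · subst hx0; simp [ee_zero]
    · rw [if_neg hx0, if_neg, mul_zero]
      intro hd
      rcases hp.dvd_or_dvd hd with h | h
      · exact hc h
      · have := Nat.le_of_dvd (Nat.pos_of_ne_zero hx0) (by exact_mod_cast h)
        rw [mem_range] at hx; omega
  rw [Finset.sum_congr rfl h1, Finset.sum_ite_eq' ]
  simp [hl.pos]

theorem sum_crt {L : ℕ} (hL : L % 12 = 1) (F : ℤ → ℂ) (hF : ∀ a b : ℤ, ((12 * L : ℕ) : ℤ) ∣ a - b → F a = F b) :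
    ∑ n ∈ range (12 * L), F n = ∑ y ∈ range 12, ∑ x ∈ range L, F (L * y + 12 * x) := by
  have hL0 : L ≠ 0 := by rintro rfl; simp at hL
  rw [← Finset.sum_product', ← sum_res (range 12 ×ˢ range L) (by omega) F hF (fun p => L * p.1 + 12 * p.2)]
  · simp
  · rintro ⟨x, t⟩ h1 ⟨y, u⟩ h2 ⟨v, hv⟩
    simp only [mem_product, mem_range] at h1 h2 hv ⊢
    push_cast at hv
    obtain ⟨q, hq⟩ : ∃ q, L = 12 * q + 1 := ⟨L / 12, by omega⟩
    have hq' : (L : ℤ) = 12 * q + 1 := by exact_mod_cast hq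
    have h3 : (x : ℤ) ≡ y [ZMOD (12 : ℕ)] := (Int.modEq_iff_dvd.mpr ⟨q * (x - y) + t - u - L * v, by
      push_cast; linear_combination -hv + (x - y) * hq'⟩)
    have hxy := Nat.ModEq.eq_of_lt_of_lt (Int.natCast_modEq_iff.mp h3) h1.1 h2.1
    subst hxy
    have h5 : (t : ℤ) - u = L * v := by linarith
    have h3 : (t : ℤ) ≡ u [ZMOD L] := (Int.modEq_iff_dvd.mpr ⟨-v, by linear_combination -h5⟩)
    have := Nat.ModEq.eq_of_lt_of_lt (Int.natCast_modEq_iff.mp h3) h1.2 h2.2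
    simp [this]

/-- Fourier transform of `chi * psi`. -/
theorem fourier_prod {L : ℕ} (hL : L % 12 = 1) (ψ : ℤ → ℂ) (hψ : ∀ a b : ℤ, (L : ℤ) ∣ a - b → ψ a = ψ b) (k : ℤ) :
    ∑ n ∈ range (12 * L), (chi n : ℂ) * ψ n * ee (k * n / (12 * L : ℕ)) =
      (Real.sqrt 12 : ℂ) * chi k * ∑ x ∈ range L, ψ (12 * x) * ee (k * x / L) := by
  have hL0 : L ≠ 0 := by rintro rfl; simp at hL
  have hLC : (L : ℂ) ≠ 0 := by exact_mod_cast hL0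
  have hc := sum_crt hL (fun n : ℤ => (chi n : ℂ) * ψ n * ee (((k * n : ℤ) : ℂ) / (12 * L : ℕ))) (fun a b h => by
    have h1 : chi a = chi b := chi_congr ((Dvd.intro (L : ℤ) (by push_cast; rfl)).trans h)
    have h2 : ψ a = ψ b := hψ _ _ ((Dvd.intro_left (12 : ℤ) (by push_cast; rfl)).trans h)
    rw [h1, h2, ee_congr (by omega) (show ((12 * L : ℕ) : ℤ) ∣ k * a - k * b by rw [← mul_sub]; exact h.mul_left _)])
  have h0 : ∀ n ∈ range (12 * L), (chi (n : ℤ) : ℂ) * ψ n * ee (k * n / (12 * L : ℕ)) =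
    (chi (n : ℤ) : ℂ) * ψ n * ee (((k * n : ℤ) : ℂ) / (12 * L : ℕ)) := fun n _ => by push_cast; rfl
  rw [Finset.sum_congr rfl h0, hc, ← gauss12 k, Finset.sum_mul]
  refine Finset.sum_congr rfl fun y _ => ?_
  rw [Finset.mul_sum]
  refine Finset.sum_congr rfl fun x _ => ?_
  obtain ⟨q, hq⟩ : ∃ q, L = 12 * q + 1 := ⟨L / 12, by omega⟩
  have hq' : (L : ℤ) = 12 * q + 1 := by exact_mod_cast hq
  have h1 : chi (L * y + 12 * x) = chi y := chi_congr ⟨q * y + x, by rw [hq']; ring⟩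
  have h2 : ψ (L * y + 12 * x) = ψ (12 * x) := hψ _ _ ⟨y, by ring⟩
  rw [h1, h2]
  have h3 : ee (((k * (L * y + 12 * x) : ℤ) : ℂ) / (12 * L : ℕ)) = ee (k * y / 12) * ee (k * x / L) := by
    rw [← ee_add]; congr 1; push_cast; field_simp
  rw [h3]; ring

noncomputable def gs (l : ℕ) [Fact l.Prime] : ℂ := ∑ b ∈ range l, (legendreSym l b : ℂ) * ee (b / l)

theorem legendre_congr {l : ℕ} [Fact l.Prime] {a b : ℤ} (h : (l : ℤ) ∣ a - b) : legendreSym l a = legendreSym l b := by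
  rw [legendreSym.mod l a, legendreSym.mod l b]
  have : a % l = b % l := (Int.modEq_iff_dvd.mpr (by rw [← neg_sub]; exact h.neg_right) : a ≡ b [ZMOD l])
  rw [this]

theorem sum_legendre {l : ℕ} [Fact l.Prime] (h2 : l ≠ 2) : ∑ b ∈ range l, (legendreSym l b : ℂ) = 0 := by
  have h := quadraticChar_sum_zero (F := ZMod l) ((ZMod.ringChar_zmod_n l).substr h2)
  have h3 := sum_zmod_val (m := l) (fun b => (legendreSym l b : ℂ))
  rw [← h3]
  have : ∀ b : ZMod l, legendreSym l (b.val : ℤ) = quadraticChar (ZMod l) b := fun b => by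
    rw [legendreSym]; congr 1; simp
  simp_rw [this]
  rw [← Int.cast_sum, h, Int.cast_zero]

theorem gs_twist {l : ℕ} [Fact l.Prime] (h2 : l ≠ 2) (N : ℤ) :
    ∑ b ∈ range l, (legendreSym l b : ℂ) * ee (N * b / l) = legendreSym l N * gs l := by
  have hl0 : l ≠ 0 := (Fact.out : l.Prime).ne_zero
  by_cases hN : (l : ℤ) ∣ N
  · have h1 : legendreSym l N = 0 := by
      rw [legendreSym.eq_zero_iff]; exact (ZMod.intCast_zmod_eq_zero_iff_dvd N l).mpr hN
    rw [h1, Int.cast_zero, zero_mul, ← sum_legendre h2]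
    refine Finset.sum_congr rfl fun b _ => ?_
    have := (ee_eq_one_iff hl0 (N * b)).mpr (hN.mul_right _)
    push_cast at this
    rw [this, mul_one]
  · have h1 : legendreSym l N * legendreSym l N = 1 := by
      have := legendreSym.sq_one l (a := N) (by rwa [Ne, ZMod.intCast_zmod_eq_zero_iff_dvd])
      rw [← sq]; exact this
    have h1' : (legendreSym l N : ℂ) * legendreSym l N = 1 := by exact_mod_cast h1
    have hp : Prime (l : ℤ) := Nat.prime_iff_prime_int.mp Fact.out
    have h3 := sum_res (range l) hl0 (fun n : ℤ => (legendreSym l n : ℂ) * ee (n / l)) (fun a b h => by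
      rw [legendre_congr h, ee_congr hl0 h]) (fun b => N * b) (by simp) (fun x hx y hy h => by
        rw [← mul_sub] at h
        rw [mem_range] at hx hy
        have h1 := (hp.dvd_or_dvd h).resolve_left hN
        have h3 : (x : ℤ) ≡ y [ZMOD l] := (Int.modEq_iff_dvd.mpr (by rw [← neg_sub]; exact h1.neg_right))
        exact Nat.ModEq.eq_of_lt_of_lt (Int.natCast_modEq_iff.mp h3) hx hy)
    have h4 : gs l = ∑ n ∈ range l, (legendreSym l (n : ℤ) : ℂ) * ee (((n : ℤ) : ℂ) / l) := by simp [gs]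
    rw [h4, ← h3, Finset.mul_sum]
    refine Finset.sum_congr rfl fun b _ => ?_
    rw [legendreSym.mul]; push_cast
    rw [← mul_assoc, ← mul_assoc, h1', one_mul]

theorem Gq_prime {l : ℕ} [Fact l.Prime] (h2 : l ≠ 2) (c : ℤ) (hc : ¬ (l : ℤ) ∣ c) :
    Gq c l = legendreSym l c * gs l := by
  have hl0 : l ≠ 0 := (Fact.out : l.Prime).ne_zero
  have e1 : Gq c l = ∑ x : ZMod l, ZMod.stdAddChar ((c : ZMod l) * x ^ 2) := by
    rw [Gq, ← sum_zmod_val (fun x : ℕ => ee (((c * (x : ℤ) ^ 2 : ℤ) : ℂ) / l))]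
    refine Finset.sum_congr rfl fun x _ => ?_
    rw [ee_std]; congr 1; push_cast; simp
  have e2 : ∑ x : ZMod l, (ZMod.stdAddChar ((c : ZMod l) * x ^ 2) : ℂ) =
      ∑ a : ZMod l, ((legendreSym l (a.val : ℤ) + 1 : ℤ) : ℂ) * ZMod.stdAddChar ((c : ZMod l) * a) := by
    rw [← Finset.sum_fiberwise (s := Finset.univ) (g := fun x : ZMod l => x ^ 2)]
    refine Finset.sum_congr rfl fun a _ => ?_
    have h3 := legendreSym.card_sqrts l h2 (a.val : ℤ)
    rw [← h3]
    have h4 : ∀ x ∈ (Finset.univ.filter fun x : ZMod l => x ^ 2 = a),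
        (ZMod.stdAddChar ((c : ZMod l) * x ^ 2) : ℂ) = ZMod.stdAddChar ((c : ZMod l) * a) := fun x hx => by
      rw [(Finset.mem_filter.mp hx).2]
    rw [Finset.sum_congr rfl h4, Finset.sum_const, nsmul_eq_mul]
    congr 2
    norm_cast
    congr 1
    ext x; simp
  have e3 : ∑ a : ZMod l, ((legendreSym l (a.val : ℤ) + 1 : ℤ) : ℂ) * ZMod.stdAddChar ((c : ZMod l) * a) =
      ∑ a ∈ range l, ((legendreSym l (a : ℤ) + 1 : ℤ) : ℂ) * ee (c * a / l) := by
    rw [← sum_zmod_val (fun a : ℕ => ((legendreSym l (a : ℤ) + 1 : ℤ) : ℂ) * ee (c * a / l))]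
    refine Finset.sum_congr rfl fun x _ => ?_
    have := ee_std (N := l) (c * x.val)
    push_cast at this ⊢
    rw [this]; simp
  rw [e1, e2, e3, ← gs_twist h2]
  push_cast
  simp_rw [add_mul, one_mul]
  rw [Finset.sum_add_distrib, sum_roots hl0, if_neg hc, add_zero]

theorem gs_sq {l : ℕ} [Fact l.Prime] (h2 : l ≠ 2) : gs l ^ 2 = (legendreSym l (-1) : ℂ) * l := by
  have hF : ringChar (ZMod l) ≠ 2 := (ZMod.ringChar_zmod_n l).substr h2
  have h1 : (quadraticChar (ZMod l)).ringHomComp (Int.castRingHom ℂ) ≠ 1 := by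
    intro h
    obtain ⟨a, ha⟩ := quadraticChar_exists_neg_one' hF
    have h3 := congr_arg (fun χ => χ (a : ZMod l)) h
    simp only [MulChar.ringHomComp_apply, ha] at h3
    rw [MulChar.one_apply a.isUnit] at h3
    norm_num at h3
  have h3 := gaussSum_sq h1 ((quadraticChar_isQuadratic (ZMod l)).comp _) (ZMod.isPrimitive_stdAddChar l)
  have h4 : gs l = gaussSum ((quadraticChar (ZMod l)).ringHomComp (Int.castRingHom ℂ)) ZMod.stdAddChar := by
    rw [gs, gaussSum, ← sum_zmod_val (fun b : ℕ => (legendreSym l b : ℂ) * ee (b / l))]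
    refine Finset.sum_congr rfl fun x _ => ?_
    have := ee_std (N := l) (x.val)
    push_cast at this
    rw [this, legendreSym]; simp
  rw [h4, h3]
  simp [legendreSym, ZMod.card]

theorem im_affine {z : ℂ} (hz : 0 < z.im) {m : ℕ} (hm : m ≠ 0) (b : ℤ) : 0 < ((z + 24 * b) / m).im := by
  have := im_div_nat hz hm (24 * b); push_cast at this; exact this

theorem et_unit {L l : ℕ} (hL : L % 12 = 1) (hLl : L = l ^ 2) (b b' : ℤ) (hb : (L : ℤ) ∣ 576 * b * b' + 1)
    (hG : Gq (144 * b') L = l) {τ : ℂ} (hτ : 0 < τ.im) :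
    et ((-1 / τ + 24 * b) / L) = ss τ * et ((τ + 24 * b') / L) := by
  have hL0 : L ≠ 0 := by rintro rfl; simp at hL
  have hl0 : l ≠ 0 := by rintro rfl; simp at hLl; omega
  have hLC : (L : ℂ) ≠ 0 := by exact_mod_cast hL0
  have hlC : (l : ℂ) ≠ 0 := by exact_mod_cast hl0
  have hτ0 : τ ≠ 0 := by rintro rfl; simp at hτ
  have hψ : ∀ a c : ℤ, (L : ℤ) ∣ a - c → ee (((b' * a ^ 2 : ℤ) : ℂ) / L) = ee (((b' * c ^ 2 : ℤ) : ℂ) / L) := fun a c hac => by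
    apply ee_congr hL0
    rw [← mul_sub]; exact Dvd.dvd.mul_left (hac.trans (sub_dvd_pow_sub_pow a c 2)) _
  obtain ⟨S, h1, h2⟩ := theta_transform (N := 12 * L) (by omega)
    (fun n : ℤ => (chi n : ℂ) * ee (((b' * n ^ 2 : ℤ) : ℂ) / L)) (fun a t => by
      rw [chi_congr (a := a + (12 * L : ℕ) * t) (b := a) ⟨L * t, by push_cast; ring⟩,
        hψ (a + (12 * L : ℕ) * t) a ⟨12 * t, by push_cast; ring⟩]) hτ
  have hS : S = 2 * et ((τ + 24 * b') / L) := by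
    refine h1.unique ?_
    refine Eq.mp (congrArg (fun f => HasSum f _) (funext fun n => ?_)) (et_hasSum (im_affine hτ hL0 b'))
    rw [mul_assoc, ← ee_add]; congr 2; push_cast; field_simp; ring
  have hk : ∀ k : ℤ, ∑ n ∈ range (12 * L), (chi n : ℂ) * ee (((b' * (n : ℤ) ^ 2 : ℤ) : ℂ) / L) * ee (k * n / (12 * L : ℕ)) =
      (Real.sqrt 12 : ℂ) * l * (chi k * ee (((b * k ^ 2 : ℤ) : ℂ) / L)) := fun k => by
    rw [fourier_prod hL (fun n : ℤ => ee (((b' * n ^ 2 : ℤ) : ℂ) / L)) hψ k]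
    have : ∀ x ∈ range L, ee (((b' * (12 * (x : ℤ)) ^ 2 : ℤ) : ℂ) / L) * ee (k * x / L) =
        ee (((144 * b' * (x : ℤ) ^ 2 + x * k : ℤ) : ℂ) / L) := fun x _ => by
      rw [← ee_add]; congr 1; push_cast; ring
    rw [Finset.sum_congr rfl this, Gq_complete hL0 b b' k hb, hG]; ring
  simp_rw [hk] at h2
  have h3 := (et_hasSum (im_affine (im_S hτ) hL0 b)).mul_left ((Real.sqrt 12 : ℂ) * l)
  have h4 := h2.unique (Eq.mp (congrArg (fun f => HasSum f _) (funext fun n => by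
    have e2 : ee (n ^ 2 * ((-1 / τ + 24 * b) / L) / 24) = ee (((b * n ^ 2 : ℤ) : ℂ) / L) *
        ee (n ^ 2 * (-1 / τ) / (2 * (12 * L : ℕ))) := by
      rw [← ee_add]; congr 1; push_cast; field_simp; ring
    rw [e2]; ring)) h3)
  rw [ss_mul hτ0 (by omega), hS] at h4
  have h12 : (Real.sqrt 12 : ℂ) ≠ 0 := by
    rw [Ne, Complex.ofReal_eq_zero, Real.sqrt_eq_zero']; norm_num
  have h5 : (Real.sqrt ((12 * L : ℕ) : ℝ) : ℂ) = Real.sqrt 12 * l := by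
    rw [hLl]; push_cast
    rw [Real.sqrt_mul (by norm_num), Real.sqrt_sq (by positivity)]; push_cast; rfl
  rw [h5] at h4
  have h6 : (Real.sqrt 12 : ℂ) * l * 2 ≠ 0 := mul_ne_zero (mul_ne_zero h12 hlC) two_ne_zero
  apply mul_left_cancel₀ h6
  linear_combination -h4

theorem et_S {τ : ℂ} (hτ : 0 < τ.im) : et (-1 / τ) = ss τ * et τ := by
  have := et_unit (L := 1) (l := 1) (by norm_num) (by norm_num) 0 0 (by simp) (by simp [Gq, ee_zero]) hτ
  simpa using this

theorem ss_inv {τ : ℂ} (hτ : 0 < τ.im) : ss (-1 / τ) * ss τ = 1 := by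
  have hτ0 : τ ≠ 0 := by rintro rfl; simp at hτ
  have h1 := et_S (im_S hτ)
  rw [et_S hτ, show -1 / (-1 / τ) = τ by field_simp] at h1
  apply mul_right_cancel₀ (et_ne_zero hτ)
  rw [one_mul, mul_assoc, ← h1]

theorem et_mid {l : ℕ} [Fact l.Prime] (h2 : l ≠ 2) (h3 : l ≠ 3) (hL : l ^ 2 % 12 = 1) (b' b'' : ℤ)
    (hb : (l : ℤ) ∣ 576 * b'' * b' + 1) {τ : ℂ} (hτ : 0 < τ.im) :
    legendreSym l b' * chi l * gs l * et (-1 / τ + 24 * b'' / l) = ss τ * et ((τ + 24 * (l * b')) / (l ^ 2 : ℕ)) := by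
  have hlp : l.Prime := Fact.out
  have hl0 : l ≠ 0 := hlp.ne_zero
  have hlC : (l : ℂ) ≠ 0 := by exact_mod_cast hl0
  have hL0 : l ^ 2 ≠ 0 := pow_ne_zero 2 hl0
  have hτ0 : τ ≠ 0 := by rintro rfl; simp at hτ
  have hp : Prime (l : ℤ) := Nat.prime_iff_prime_int.mp hlp
  have hψ : ∀ a c : ℤ, ((l ^ 2 : ℕ) : ℤ) ∣ a - c → ee (((l * b' * a ^ 2 : ℤ) : ℂ) / (l ^ 2 : ℕ)) = ee (((l * b' * c ^ 2 : ℤ) : ℂ) / (l ^ 2 : ℕ)) := fun a c hac => by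
    apply ee_congr hL0
    rw [← mul_sub]; exact Dvd.dvd.mul_left (hac.trans (sub_dvd_pow_sub_pow a c 2)) _
  obtain ⟨S, h1, hh⟩ := theta_transform (N := 12 * l ^ 2) (by omega)
    (fun n : ℤ => (chi n : ℂ) * ee (((l * b' * n ^ 2 : ℤ) : ℂ) / (l ^ 2 : ℕ))) (fun a t => by
      rw [chi_congr (a := a + (12 * l ^ 2 : ℕ) * t) (b := a) ⟨l ^ 2 * t, by push_cast; ring⟩,
        hψ (a + (12 * l ^ 2 : ℕ) * t) a ⟨12 * t, by push_cast; ring⟩]) hτ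
  have hS : S = 2 * et ((τ + 24 * (l * b')) / (l ^ 2 : ℕ)) := by
    refine h1.unique ?_
    have := im_affine hτ hL0 (l * b')
    push_cast at this
    refine Eq.mp (congrArg (fun f => HasSum f _) (funext fun n => ?_)) (et_hasSum (by push_cast; exact this))
    rw [mul_assoc, ← ee_add]; congr 2; push_cast; field_simp; ring
  have hb'0 : ¬ (l : ℤ) ∣ b' := fun h => by
    have : (l : ℤ) ∣ 1 := by simpa using dvd_sub hb (h.mul_left (576 * b''))
    exact hp.not_dvd_one this
  have h12' : ¬ (l : ℤ) ∣ 12 := fun h => by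
    have h0 : l ∣ 12 := by exact_mod_cast h
    have h0' : l ∣ 2 ^ 2 * 3 := h0
    rcases (Nat.Prime.dvd_mul hlp).mp h0' with h | h
    · exact h2 ((Nat.prime_dvd_prime_iff_eq hlp Nat.prime_two).mp (hlp.dvd_of_dvd_pow h))
    · exact h3 ((Nat.prime_dvd_prime_iff_eq hlp Nat.prime_three).mp h)
  have hG : Gq (144 * b') l = legendreSym l b' * gs l := by
    have h144 : ¬ (l : ℤ) ∣ 144 * b' := fun h => by
      rcases hp.dvd_or_dvd h with h | h
      · exact h12' (hp.dvd_of_dvd_pow (show (l : ℤ) ∣ 12 ^ 2 by simpa using h))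
      · exact hb'0 h
    rw [Gq_prime h2 _ h144, legendreSym.mul, show (144 : ℤ) = 12 ^ 2 by norm_num, legendreSym.sq_one' l]
    · simp
    · rw [Ne, ZMod.intCast_zmod_eq_zero_iff_dvd]; exact h12'
  have hk : ∀ k : ℤ, ∑ n ∈ range (12 * l ^ 2), (chi n : ℂ) * ee (((l * b' * (n : ℤ) ^ 2 : ℤ) : ℂ) / (l ^ 2 : ℕ)) * ee (k * n / (12 * l ^ 2 : ℕ)) =
      (Real.sqrt 12 : ℂ) * chi k * (l * if (l : ℤ) ∣ k then ∑ x ∈ range l, ee (((144 * l * b' * (x : ℤ) ^ 2 + x * k : ℤ) : ℂ) / (l ^ 2 : ℕ)) else 0) := fun k => by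
    rw [fourier_prod hL (fun n : ℤ => ee (((l * b' * n ^ 2 : ℤ) : ℂ) / (l ^ 2 : ℕ))) hψ k]
    have : ∀ x ∈ range (l ^ 2), ee (((l * b' * (12 * (x : ℤ)) ^ 2 : ℤ) : ℂ) / (l ^ 2 : ℕ)) * ee (k * x / (l ^ 2 : ℕ)) =
        ee (((144 * l * b' * (x : ℤ) ^ 2 + x * k : ℤ) : ℂ) / (l ^ 2 : ℕ)) := fun x _ => by
      rw [← ee_add]; congr 1; push_cast; ring
    rw [Finset.sum_congr rfl this]
    congr 1
    rw [sum_dig hl0 (fun x : ℤ => ee (((144 * l * b' * x ^ 2 + x * k : ℤ) : ℂ) / (l ^ 2 : ℕ))) (fun a c hac => by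
      apply ee_congr hL0
      have e1 := hac.trans (sub_dvd_pow_sub_pow a c 2)
      have e2 := dvd_add (e1.mul_left (144 * l * b')) (hac.mul_right k)
      have e3 : ((l ^ 2 : ℕ) : ℤ) ∣ (144 * l * b' * a ^ 2 + a * k) - (144 * l * b' * c ^ 2 + c * k) := by
        have e4 : (144 * l * b' * a ^ 2 + a * k) - (144 * l * b' * c ^ 2 + c * k) =
          144 * l * b' * (a ^ 2 - c ^ 2) + (a - c) * k := by ring
        rw [e4]; exact e2
      exact e3)]
    have e : ∀ x ∈ range l, ∑ t ∈ range l, ee (((144 * l * b' * ((x : ℤ) + l * t) ^ 2 + (x + l * t) * k : ℤ) : ℂ) / (l ^ 2 : ℕ)) =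
      ee (((144 * l * b' * (x : ℤ) ^ 2 + x * k : ℤ) : ℂ) / (l ^ 2 : ℕ)) * (if (l : ℤ) ∣ k then (l : ℂ) else 0) := fun x _ => by
      rw [← sum_roots hl0, Finset.mul_sum]
      refine Finset.sum_congr rfl fun t _ => ?_
      rw [← ee_add, ← ee_add_int (((144 * l * b' * (x : ℤ) ^ 2 + x * k : ℤ) : ℂ) / (l ^ 2 : ℕ) + k * t / l)
        (144 * b' * (2 * x * t + l * t ^ 2))]
      congr 1; push_cast; field_simp; ring
    rw [Finset.sum_congr rfl e, ← Finset.sum_mul]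
    split_ifs <;> ring
  simp_rw [hk] at hh
  have hinj : Function.Injective (fun j : ℤ => (l : ℤ) * j) := fun x y hxy => by
    simpa [hl0] using hxy
  rw [← hinj.hasSum_iff (fun k hk => by
    rw [if_neg (fun ⟨j, hj⟩ => hk ⟨j, hj.symm⟩)]; simp)] at hh
  have him : 0 < (-1 / τ + 24 * b'' / l).im := by
    have h1 := im_affine (im_nat_mul (im_S hτ) hl0) hl0 b''
    have : (l * (-1 / τ) + 24 * b'') / l = -1 / τ + 24 * b'' / l := by field_simp
    rwa [this] at h1
  have h5 := (et_hasSum him).mul_left ((Real.sqrt 12 : ℂ) * l * (legendreSym l b' * chi l * gs l))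
  have h4 := hh.unique (Eq.mp (congrArg (fun f => HasSum f _) (funext fun j => by
    simp only [Function.comp, dvd_mul_right, if_true]
    have e : ∀ x ∈ range l, ee (((144 * l * b' * (x : ℤ) ^ 2 + x * (l * j) : ℤ) : ℂ) / (l ^ 2 : ℕ)) =
        ee (((144 * b' * (x : ℤ) ^ 2 + x * j : ℤ) : ℂ) / l) := fun x _ => by
      congr 1; push_cast; field_simp
    rw [Finset.sum_congr rfl e, Gq_complete hl0 b'' b' j hb, hG, chi_mul]
    have e2 : ee (j ^ 2 * (-1 / τ + 24 * b'' / l) / 24) = ee (((b'' * j ^ 2 : ℤ) : ℂ) / l) * 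
      ee (((l * j : ℤ) : ℂ) ^ 2 * (-1 / τ) / (2 * (12 * l ^ 2 : ℕ))) := by
      rw [← ee_add]; congr 1; push_cast; field_simp; ring
    rw [e2]; push_cast; ring)) h5)
  rw [ss_mul hτ0 (by omega), hS] at h4
  have h12 : (Real.sqrt 12 : ℂ) ≠ 0 := by
    rw [Ne, Complex.ofReal_eq_zero, Real.sqrt_eq_zero']; norm_num
  have h5 : (Real.sqrt ((12 * l ^ 2 : ℕ) : ℝ) : ℂ) = Real.sqrt 12 * l := by
    push_cast
    rw [Real.sqrt_mul (by norm_num), Real.sqrt_sq (by positivity)]; push_cast; rfl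
  rw [h5] at h4
  have h6 : (Real.sqrt 12 : ℂ) * l * 2 ≠ 0 := mul_ne_zero (mul_ne_zero h12 hlC) two_ne_zero
  apply mul_left_cancel₀ h6
  linear_combination -h4

noncomputable def gg (A : ℤ⟦X⟧) (r : ℕ) (z : ℂ) : ℂ := et z ^ r * Ev (cc A) (ee z)
noncomputable def JJ (r w : ℕ) (z : ℂ) : ℂ := ss z ^ r * z ^ w

theorem JJ_inv {r w : ℕ} (hw : Even w) {τ : ℂ} (hτ : 0 < τ.im) : JJ r w τ * JJ r w (-1 / τ) = 1 := by
  have hτ0 : τ ≠ 0 := by rintro rfl; simp at hτ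
  have h1 := ss_inv hτ
  have h2 : τ * (-1 / τ) = -1 := by field_simp
  calc _ = (ss (-1 / τ) * ss τ) ^ r * (τ * (-1 / τ)) ^ w := by rw [JJ, JJ]; ring
    _ = 1 := by rw [h1, h2, hw.neg_one_pow, one_pow, one_mul]

theorem gg_unit {A : ℤ⟦X⟧} {w : ℕ} (hA : MF w A) (r : ℕ) {l : ℕ} (hl : l.Prime)
    (hL : l ^ 2 % 12 = 1) (b b' : ℤ) (hb : ((l ^ 2 : ℕ) : ℤ) ∣ 576 * b * b' + 1) {τ : ℂ} (hτ : 0 < τ.im) :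
    gg A r ((-1 / τ + 24 * b) / (l ^ 2 : ℕ)) = JJ r w τ * gg A r ((τ + 24 * b') / (l ^ 2 : ℕ)) := by
  have hp : Prime (l : ℤ) := Nat.prime_iff_prime_int.mp hl
  have hτ0 : τ ≠ 0 := by rintro rfl; simp at hτ
  have hL0 : l ^ 2 ≠ 0 := pow_ne_zero 2 hl.ne_zero
  have hLC : ((l ^ 2 : ℕ) : ℂ) ≠ 0 := by exact_mod_cast hL0
  have hc : ¬ (l : ℤ) ∣ 2 * (144 * b') := fun h => by
    have h1 : (l : ℤ) ∣ 576 * b * b' + 1 := dvd_trans ⟨l, by push_cast; ring⟩ hb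
    have : (l : ℤ) ∣ 1 := by
      have h4 := dvd_sub h1 (h.mul_left (2 * b))
      have h5 : 576 * b * b' + 1 - 2 * b * (2 * (144 * b')) = 1 := by ring
      rwa [h5] at h4
    exact hp.not_dvd_one this
  have h1 := et_unit hL rfl b b' hb (Gq_sq hl _ hc) hτ
  obtain ⟨e, he⟩ := hb
  have h4 := MF.action hA (24 * b) (-e) (l ^ 2 : ℕ) (-(24 * b')) (by linear_combination -he) (im_affine hτ hL0 b')
  have heC : (576 * b * b' + 1 : ℂ) = (l ^ 2 : ℕ) * e := by exact_mod_cast he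
  have e1 : (((l ^ 2 : ℕ) : ℤ) : ℂ) * ((τ + 24 * b') / (l ^ 2 : ℕ)) + ((-(24 * b') : ℤ) : ℂ) = τ := by
    rw [Int.cast_natCast, mul_div_cancel₀ _ hLC]; push_cast; ring
  have e2 : ((24 * b : ℤ) : ℂ) * ((τ + 24 * b') / (l ^ 2 : ℕ)) + ((-e : ℤ) : ℂ) = (24 * b * τ - 1) / (l ^ 2 : ℕ) := by
    field_simp
    push_cast at heC ⊢
    linear_combination heC
  rw [e1, e2, show (24 * b * τ - 1) / ((l ^ 2 : ℕ) : ℂ) / τ = (-1 / τ + 24 * b) / (l ^ 2 : ℕ) by field_simp; ring] at h4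
  rw [gg, gg, h1, h4, JJ]; ring

theorem gg_mid {A : ℤ⟦X⟧} {w : ℕ} (hA : MF w A) {r : ℕ} (hr : Odd r) {l : ℕ} [Fact l.Prime] (h2 : l ≠ 2) (h3 : l ≠ 3)
    (hL : l ^ 2 % 12 = 1) (b' b'' : ℤ) (hb : (l : ℤ) ∣ 576 * b'' * b' + 1) {τ : ℂ} (hτ : 0 < τ.im) :
    legendreSym l b' * (chi l * gs l) ^ r * l ^ w * gg A r (-1 / τ + 24 * b'' / l) =
      JJ r w τ * gg A r ((τ + 24 * (l * b')) / (l ^ 2 : ℕ)) := by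
  have hl : l.Prime := Fact.out
  have hτ0 : τ ≠ 0 := by rintro rfl; simp at hτ
  have hL0 : l ^ 2 ≠ 0 := pow_ne_zero 2 hl.ne_zero
  have hlC : (l : ℂ) ≠ 0 := by exact_mod_cast hl.ne_zero
  have h1 := et_mid h2 h3 hL b' b'' hb hτ
  have hodd : (legendreSym l b' : ℂ) ^ r = legendreSym l b' := by
    obtain ⟨t, rfl⟩ := hr
    by_cases h : (b' : ZMod l) = 0
    · rw [(legendreSym.eq_zero_iff l b').mpr h]; simp
    · rcases legendreSym.eq_one_or_neg_one l h with h | h <;> rw [h] <;> simp [pow_succ, pow_mul]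
  obtain ⟨e, he⟩ := hb
  have him := im_affine hτ hL0 (l * b')
  have h4 := MF.action hA (24 * b'') (-e) l (-(24 * b')) (by linear_combination -he) him
  have heC : (576 * b'' * b' + 1 : ℂ) = l * e := by exact_mod_cast he
  push_cast at h4 h1 ⊢
  have e1 : (l : ℂ) * ((τ + 24 * (l * b')) / (l : ℂ) ^ 2) + -(24 * b') = τ / l := by
    field_simp; ring
  have e2 : (24 * b'' : ℂ) * ((τ + 24 * (l * b')) / (l : ℂ) ^ 2) + -e = (24 * b'' * τ - l) / (l : ℂ) ^ 2 := by
    field_simp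
    linear_combination (l : ℂ) * heC
  rw [e1, e2, show (24 * b'' * τ - l) / (l : ℂ) ^ 2 / (τ / l) = -1 / τ + 24 * b'' / l by field_simp; ring] at h4
  rw [gg, gg, h4, JJ, ← hodd]
  have h5 := congrArg (· ^ r) h1
  simp only [mul_pow] at h5
  have h6 : (l : ℂ) ^ w * (τ / l) ^ w = τ ^ w := by rw [← mul_pow, mul_div_cancel₀ _ hlC]
  rw [mul_pow]
  linear_combination (l : ℂ) ^ w * (τ / l) ^ w * Ev (cc A) (ee ((τ + 24 * (l * b')) / (l : ℂ) ^ 2)) * h5 + 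
    ss τ ^ r * et ((τ + 24 * (l * b')) / (l : ℂ) ^ 2) ^ r * Ev (cc A) (ee ((τ + 24 * (l * b')) / (l : ℂ) ^ 2)) * h6

theorem gg_zero {A : ℤ⟦X⟧} {w : ℕ} (hA : MF w A) (r : ℕ) {l : ℕ} (hl : l ≠ 0) {τ : ℂ} (hτ : 0 < τ.im) :
    l ^ (r + 2 * w) * gg A r ((l ^ 2 : ℕ) * (-1 / τ)) = JJ r w τ * gg A r (τ / (l ^ 2 : ℕ)) := by
  have hτ0 : τ ≠ 0 := by rintro rfl; simp at hτ
  have hL0 : l ^ 2 ≠ 0 := pow_ne_zero 2 hl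
  have hlC : (l : ℂ) ≠ 0 := by exact_mod_cast hl
  have hLC : ((l ^ 2 : ℕ) : ℂ) ≠ 0 := by exact_mod_cast hL0
  have him : 0 < (τ / (l ^ 2 : ℕ)).im := by simpa using im_affine hτ hL0 0
  have e : ((l ^ 2 : ℕ) : ℂ) * (-1 / τ) = -1 / (τ / (l ^ 2 : ℕ)) := by field_simp
  have h1 := ss_mul (z := τ / (l ^ 2 : ℕ)) (div_ne_zero hτ0 hLC) hL0
  rw [mul_div_cancel₀ _ hLC] at h1
  have h5 : (Real.sqrt ((l ^ 2 : ℕ) : ℝ) : ℂ) = l := by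
    push_cast; rw [Real.sqrt_sq (by positivity)]; push_cast; rfl
  rw [h5] at h1
  rw [gg, gg, e, et_S him, hA.2 _ him, JJ, h1]
  have h6 : (l : ℂ) ^ (2 * w) * (τ / (l ^ 2 : ℕ)) ^ w = τ ^ w := by
    rw [pow_mul, ← mul_pow]; push_cast; rw [mul_div_cancel₀ _ (pow_ne_zero 2 hlC)]
  rw [← h6]; ring

theorem range_units {l e : ℕ} [NeZero (l ^ e)] (hl : l.Prime) (he : e ≠ 0) (f : ℕ → ℂ) :
    ∑ b ∈ range (l ^ e), (if l ∣ b then 0 else f b) = ∑ u : (ZMod (l ^ e))ˣ, f (u : ZMod (l ^ e)).val := by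
  rw [← sum_zmod_val]
  symm
  refine Finset.sum_of_injOn (fun u : (ZMod (l ^ e))ˣ => (u : ZMod (l ^ e))) (fun a _ b _ h => Units.ext h) (by simp [Set.MapsTo]) ?_ ?_
  · intro x _ hx
    rw [if_pos]
    by_contra h
    have hc : Nat.Coprime x.val (l ^ e) := (Nat.Coprime.pow_left e ((Nat.Prime.coprime_iff_not_dvd hl).mpr h)).symm
    exact hx ⟨ZMod.unitOfCoprime _ hc, by simp, by simp⟩
  · intro u _
    rw [if_neg]
    intro h
    have hc := ZMod.val_coe_unit_coprime u
    have := Nat.Coprime.eq_one_of_dvd (hc.coprime_dvd_left h) (dvd_pow_self l he)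
    exact hl.one_lt.ne' this

theorem unit_sum {l e : ℕ} (hl : l.Prime) (h2 : l ≠ 2) (h3 : l ≠ 3) (he : e ≠ 0) (f g : ℕ → ℂ)
    (h : ∀ b b' : ℕ, ((l ^ e : ℕ) : ℤ) ∣ 576 * b * b' + 1 → f b = g b') :
    ∑ b ∈ range (l ^ e), (if l ∣ b then 0 else f b) = ∑ b ∈ range (l ^ e), (if l ∣ b then 0 else g b) := by
  have : NeZero (l ^ e) := ⟨pow_ne_zero e hl.ne_zero⟩
  have hc : Nat.Coprime 576 (l ^ e) := by
    apply Nat.Coprime.pow_right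
    have e2 : Nat.Coprime 2 l := (Nat.coprime_primes Nat.prime_two hl).mpr (Ne.symm h2)
    have e3 : Nat.Coprime 3 l := (Nat.coprime_primes Nat.prime_three hl).mpr (Ne.symm h3)
    have := (e2.pow_left 6).mul_left (e3.pow_left 2)
    norm_num at this
    exact this
  rw [range_units hl he, range_units hl he]
  let c := ZMod.unitOfCoprime 576 hc
  have hi : Function.Involutive (fun u : (ZMod (l ^ e))ˣ => -(c * u)⁻¹) := fun u => by
    simp only [mul_inv, mul_neg, inv_neg, neg_neg, inv_inv]
    simp [mul_comm]
  refine Fintype.sum_equiv (Function.Involutive.toPerm _ hi) _ _ fun u => ?_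
  apply h
  rw [← ZMod.intCast_zmod_eq_zero_iff_dvd]
  push_cast
  rw [ZMod.natCast_zmod_val, ZMod.natCast_zmod_val]
  have : (576 : ZMod (l ^ e)) = (c : ZMod (l ^ e)) := by simp [c]
  rw [this]
  have h5 : (Function.Involutive.toPerm _ hi) u = -(c * u)⁻¹ := rfl
  rw [h5]
  have h6 : ((c * u * (-(c * u)⁻¹) : (ZMod (l ^ e))ˣ) : ZMod (l ^ e)) = ((-1 : (ZMod (l ^ e))ˣ) : ZMod (l ^ e)) := by
    congr 1; simp
  rw [Units.val_mul, Units.val_mul] at h6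
  rw [h6]; simp

theorem range_split {l : ℕ} (hl : l.Prime) (f : ℕ → ℂ) :
    ∑ b ∈ range (l ^ 2), f b = ∑ b ∈ range (l ^ 2), (if l ∣ b then 0 else f b) +
      (∑ b ∈ range l, (if l ∣ b then 0 else f (l * b)) + f 0) := by
  have h1 : ∑ b ∈ range l, (if l ∣ b then 0 else f (l * b)) + f 0 = ∑ b ∈ range l, f (l * b) := by
    rw [← Finset.sum_erase_add _ _ (mem_range.mpr hl.pos), ← Finset.sum_erase_add (range l) (fun b => f (l * b)) (mem_range.mpr hl.pos)]
    simp only [dvd_zero, if_true, add_zero, mul_zero]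
    congr 1
    refine Finset.sum_congr rfl fun b hb => ?_
    rw [if_neg]
    intro h
    rw [mem_erase, mem_range] at hb
    exact hb.1 (Nat.eq_zero_of_dvd_of_lt h hb.2)
  have h2 : ∑ b ∈ range l, f (l * b) = ∑ b ∈ range (l ^ 2), (if l ∣ b then f b else 0) := by
    refine Finset.sum_of_injOn (fun b => l * b) (fun a _ b _ h => Nat.eq_of_mul_eq_mul_left hl.pos h) ?_ ?_ ?_
    · intro b hb
      simp only [coe_range, Set.mem_Iio] at hb ⊢
      nlinarith [hl.pos]
    · intro b hb h
      rw [if_neg]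
      rintro ⟨c, rfl⟩
      refine h ⟨c, ?_, rfl⟩
      simp only [coe_range, Set.mem_Iio]
      rw [mem_range, sq] at hb
      exact lt_of_mul_lt_mul_left hb hl.pos.le
    · intro b _; simp
  rw [h1, h2, ← Finset.sum_add_distrib]
  refine Finset.sum_congr rfl fun b _ => ?_
  split_ifs <;> simp

noncomputable def GG (A : ℤ⟦X⟧) (r w l : ℕ) [Fact l.Prime] (τ : ℂ) : ℂ :=
  (1 / l ^ 2) * ∑ b ∈ range (l ^ 2), gg A r ((τ + 24 * b) / (l ^ 2 : ℕ)) +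
  (1 / l ^ 2 * legendreSym l (-1) * (chi l * gs l) ^ r * l ^ w) * ∑ b ∈ range l, legendreSym l b * gg A r (τ + 24 * b / l) +
  (1 / l ^ 2 * l ^ (r + 2 * w)) * gg A r ((l ^ 2 : ℕ) * τ)

theorem GG_S {A : ℤ⟦X⟧} {w : ℕ} (hw : Even w) (hA : MF w A) {r : ℕ} (hr : Odd r) {l : ℕ} [Fact l.Prime] (h2 : l ≠ 2) (h3 : l ≠ 3)
    (hL : l ^ 2 % 12 = 1) {τ : ℂ} (hτ : 0 < τ.im) : GG A r w l (-1 / τ) = JJ r w τ * GG A r w l τ := by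
  have hl : l.Prime := Fact.out
  have hτ0 : τ ≠ 0 := by rintro rfl; simp at hτ
  have hSS : -1 / (-1 / τ) = τ := by field_simp
  have hJ := JJ_inv (r := r) hw hτ
  let U : ℂ → ℂ := fun τ => ∑ b ∈ range (l ^ 2), (if l ∣ b then 0 else gg A r ((τ + 24 * b) / (l ^ 2 : ℕ)))
  let V : ℂ → ℂ := fun τ => ∑ b ∈ range l, (if l ∣ b then 0 else gg A r ((τ + 24 * (l * b)) / (l ^ 2 : ℕ)))
  let W : ℂ → ℂ := fun τ => ∑ b ∈ range l, legendreSym l b * gg A r (τ + 24 * b / l)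
  have hH : ∀ τ, ∑ b ∈ range (l ^ 2), gg A r ((τ + 24 * b) / (l ^ 2 : ℕ)) = U τ + (V τ + gg A r (τ / (l ^ 2 : ℕ))) := fun τ => by
    rw [range_split hl (fun b => gg A r ((τ + 24 * b) / (l ^ 2 : ℕ)))]
    simp only [U, V]
    push_cast
    simp
  have hU : U (-1 / τ) = JJ r w τ * U τ := by
    simp only [U]
    rw [unit_sum hl h2 h3 two_ne_zero _ (fun b => JJ r w τ * gg A r ((τ + 24 * b) / (l ^ 2 : ℕ))) (fun b b' hb => by
      have := gg_unit hA r hl hL b b' hb hτ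
      exact_mod_cast this), Finset.mul_sum]
    refine Finset.sum_congr rfl fun b _ => ?_
    split_ifs <;> simp
  have hW : ∀ {τ : ℂ}, 0 < τ.im → (legendreSym l (-1) * (chi l * gs l) ^ r * l ^ w) * W (-1 / τ) = JJ r w τ * V τ := fun {τ} hτ => by
    have h := unit_sum hl h2 h3 one_ne_zero 
      (fun b => (legendreSym l (-1) * (chi l * gs l) ^ r * l ^ w) * (legendreSym l b * gg A r (-1 / τ + 24 * b / l)))
      (fun b => JJ r w τ * gg A r ((τ + 24 * (l * b)) / (l ^ 2 : ℕ))) (fun b b' hb => by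
        rw [pow_one] at hb
        have h1 := gg_mid hA hr h2 h3 hL b' b hb hτ
        have h4 : legendreSym l b' = legendreSym l (-1) * legendreSym l b := by
          have h5 : legendreSym l (24 ^ 2 * (b * b')) = legendreSym l (-1) := 
            legendre_congr (by convert hb using 1; ring)
          have h6 : ¬ (l : ℤ) ∣ 576 * b * b' := fun h => by
            have h7 : (l : ℤ) ∣ 1 := by simpa using dvd_sub hb h
            exact (Nat.prime_iff_prime_int.mp hl).not_dvd_one h7
          have hb0 : ((b : ℤ) : ZMod l) ≠ 0 := by
            rw [Ne, ZMod.intCast_zmod_eq_zero_iff_dvd]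
            exact fun h => h6 ((h.mul_left 576).mul_right _)
          have h24 : ((24 : ℤ) : ZMod l) ≠ 0 := by
            rw [Ne, ZMod.intCast_zmod_eq_zero_iff_dvd]
            exact fun h => h6 (by rw [mul_assoc]; exact (Dvd.dvd.mul_right (h.trans ⟨24, by norm_num⟩) _))
          rw [legendreSym.mul, legendreSym.sq_one' l h24, one_mul, legendreSym.mul] at h5
          have h8 := legendreSym.sq_one l hb0
          rw [← h5, mul_comm (legendreSym l (b : ℤ)), mul_assoc, ← sq, h8, mul_one]
        rw [h4] at h1
        push_cast at h1 ⊢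
        rw [← h1]; ring)
    rw [pow_one] at h
    simp only [W, V]
    rw [Finset.mul_sum, Finset.mul_sum]
    calc _ = _ := Finset.sum_congr rfl fun b _ => ?_
      _ = _ := h
      _ = _ := Finset.sum_congr rfl fun b _ => ?_
    · split_ifs with hb
      · have : legendreSym l b = 0 := by
          rw [legendreSym.eq_zero_iff, ZMod.intCast_zmod_eq_zero_iff_dvd]; exact_mod_cast hb
        rw [this]; simp
      · rfl
    · split_ifs <;> simp
  have hV : V (-1 / τ) = JJ r w τ * ((legendreSym l (-1) * (chi l * gs l) ^ r * l ^ w) * W τ) := by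
    have h := hW (im_S hτ)
    rw [hSS] at h
    rw [h, ← mul_assoc, hJ, one_mul]
  have hZ := gg_zero hA r hl.ne_zero hτ
  have hZ' := gg_zero hA r hl.ne_zero (im_S hτ)
  rw [hSS] at hZ'
  have hZ2 : gg A r (-1 / τ / (l ^ 2 : ℕ)) = JJ r w τ * (l ^ (r + 2 * w) * gg A r ((l ^ 2 : ℕ) * τ)) := by
    rw [hZ', ← mul_assoc, hJ, one_mul]
  have hGG : ∀ τ, GG A r w l τ = (1 / l ^ 2) * (U τ + (V τ + gg A r (τ / (l ^ 2 : ℕ))) + 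
      (legendreSym l (-1) * (chi l * gs l) ^ r * l ^ w) * W τ + l ^ (r + 2 * w) * gg A r ((l ^ 2 : ℕ) * τ)) := fun τ => by
    rw [GG, hH]; simp only [W]; ring
  rw [hGG, hGG, hU, hW hτ, hV, hZ2, hZ]
  ring

noncomputable def ta (a : ℤ⟦X⟧) (r N : ℕ) : ℤ := if N % 24 = r then a.coeff (N / 24) else 0

theorem hasSum_ta_iff {r : ℕ} (_hr : r < 24) (t : ℕ → ℤ) (ht : ∀ N, N % 24 ≠ r → t N = 0) (z S : ℂ) :
    HasSum (fun N : ℕ => (t N : ℂ) * ee (N * z / 24)) S ↔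
    HasSum (fun j : ℕ => ee (z / 24) ^ r * ((t (24 * j + r) : ℂ) * ee z ^ j)) S := by
  have hinj : Function.Injective (fun j : ℕ => 24 * j + r) := fun a b h => by
    simp only at h; omega
  rw [← hinj.hasSum_iff (fun N hN => ?_)]
  · have : ((fun N : ℕ => (t N : ℂ) * ee (N * z / 24)) ∘ fun j : ℕ => 24 * j + r) =
      (fun j : ℕ => ee (z / 24) ^ r * ((t (24 * j + r) : ℂ) * ee z ^ j)) := by
      funext j
      simp only [Function.comp]
      have : ee (((24 * j + r : ℕ) : ℂ) * z / 24) = ee (z / 24) ^ r * ee z ^ j := by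
        rw [← ee_nat_mul, ← ee_nat_mul, ← ee_add]; congr 1; push_cast; ring
      rw [this]; ring
    rw [this]
  · rw [ht N (fun h => hN ⟨N / 24, by simp only; omega⟩)]; simp

theorem hasSum_ta {r : ℕ} (hr : r < 24) {a : ℤ⟦X⟧} (ha : Conv (cc a)) {z : ℂ} (hz : 0 < z.im) :
    HasSum (fun N : ℕ => (ta a r N : ℂ) * ee (N * z / 24)) (ee (z / 24) ^ r * Ev (cc a) (ee z)) := by
  rw [hasSum_ta_iff hr (ta a r) (fun N hN => if_neg hN)]
  refine Eq.mp (congrArg (fun f => HasSum f _) (funext fun j => ?_)) ((ha.hasSum (ee_norm_lt hz)).mul_left _)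
  have h1 : (24 * j + r) % 24 = r := by omega
  have h2 : (24 * j + r) / 24 = j := by omega
  simp only [ta, h1, h2, if_true, coeff_map]
  simp

theorem gg_eq {A : ℤ⟦X⟧} (hA : Conv (cc A)) (r : ℕ) {z : ℂ} (hz : 0 < z.im) :
    gg A r z = ee (z / 24) ^ r * Ev (cc (A * PP ^ r)) (ee z) := by
  rw [gg, et, map_mul, map_pow, Ev_mul hA (Conv_PP.pow r) (ee_norm_lt hz), Ev_pow Conv_PP r (ee_norm_lt hz)]
  ring

theorem hasSum_gg {A : ℤ⟦X⟧} (hA : Conv (cc A)) {r : ℕ} (hr : r < 24) {z : ℂ} (hz : 0 < z.im) :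
    HasSum (fun N : ℕ => (ta (A * PP ^ r) r N : ℂ) * ee (N * z / 24)) (gg A r z) := by
  rw [gg_eq hA r hz]
  exact hasSum_ta hr (by rw [map_mul, map_pow]; exact hA.mul (Conv_PP.pow r)) hz

theorem hasSum_H1 {A : ℤ⟦X⟧} (hA : Conv (cc A)) {r : ℕ} (hr : r < 24) {L : ℕ} (hL : L ≠ 0) {τ : ℂ} (hτ : 0 < τ.im) :
    HasSum (fun N : ℕ => (ta (A * PP ^ r) r (L * N) : ℂ) * ee (N * τ / 24))
      ((1 / L) * ∑ b ∈ range L, gg A r ((τ + 24 * b) / L)) := by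
  have hLC : (L : ℂ) ≠ 0 := by exact_mod_cast hL
  have h1 := (hasSum_sum (s := range L) (fun b _ => hasSum_gg hA hr (im_affine hτ hL (b : ℤ)))).mul_left (1 / (L : ℂ))
  have h3 : ∀ N : ℕ, (1 / (L : ℂ)) * ∑ b ∈ range L, (ta (A * PP ^ r) r N : ℂ) * ee (N * ((τ + 24 * ((b : ℤ) : ℂ)) / L) / 24) =
      if L ∣ N then (ta (A * PP ^ r) r N : ℂ) * ee (N * τ / (24 * L)) else 0 := fun N => by
    have : ∀ b ∈ range L, (ta (A * PP ^ r) r N : ℂ) * ee (N * ((τ + 24 * ((b : ℤ) : ℂ)) / L) / 24) =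
        ((ta (A * PP ^ r) r N : ℂ) * ee (N * τ / (24 * L))) * ee ((N : ℤ) * b / L) := fun b _ => by
      rw [mul_assoc, ← ee_add]
      congr 2; push_cast; field_simp
    rw [Finset.sum_congr rfl this, ← Finset.mul_sum, sum_roots hL]
    by_cases h : L ∣ N
    · rw [if_pos h, if_pos (by exact_mod_cast h)]; field_simp
    · rw [if_neg h, if_neg (by exact_mod_cast h)]; simp
  simp_rw [h3] at h1
  have hinj : Function.Injective (fun n : ℕ => L * n) := fun a b h => Nat.eq_of_mul_eq_mul_left (Nat.pos_of_ne_zero hL) h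
  rw [← hinj.hasSum_iff (fun n hn => if_neg (fun ⟨k, hk⟩ => hn ⟨k, hk.symm⟩))] at h1
  refine Eq.mp (congrArg (fun f => HasSum f _) (funext fun n => ?_)) (by simpa only [Int.cast_natCast] using h1)
  simp only [Function.comp, dvd_mul_right, if_true]
  congr 2; push_cast; field_simp

theorem hasSum_H2 {A : ℤ⟦X⟧} (hA : Conv (cc A)) {r : ℕ} (hr : r < 24) {l : ℕ} [Fact l.Prime] (h2 : l ≠ 2) {τ : ℂ} (hτ : 0 < τ.im) :
    HasSum (fun N : ℕ => (legendreSym l N * gs l * ta (A * PP ^ r) r N : ℂ) * ee (N * τ / 24))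
      (∑ b ∈ range l, legendreSym l b * gg A r (τ + 24 * b / l)) := by
  have hl : l.Prime := Fact.out
  have hlC : (l : ℂ) ≠ 0 := by exact_mod_cast hl.ne_zero
  have him : ∀ b : ℕ, 0 < (τ + 24 * b / l).im := fun b => by
    have h1 := im_affine (im_nat_mul hτ hl.ne_zero) hl.ne_zero b
    have : (l * τ + 24 * ((b : ℤ) : ℂ)) / l = τ + 24 * b / l := by push_cast; field_simp
    rwa [this] at h1
  have h1 := (hasSum_sum (s := range l) (fun b _ => (hasSum_gg hA hr (him b)).mul_left (legendreSym l b : ℂ)))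
  refine Eq.mp (congrArg (fun f => HasSum f _) (funext fun N => ?_)) h1
  have : ∀ b ∈ range l, (legendreSym l b : ℂ) * ((ta (A * PP ^ r) r N : ℂ) * ee (N * (τ + 24 * b / l) / 24)) =
      ((ta (A * PP ^ r) r N : ℂ) * ee (N * τ / 24)) * (legendreSym l b * ee ((N : ℤ) * b / l)) := fun b _ => by
    have : ee (N * (τ + 24 * b / l) / 24) = ee (N * τ / 24) * ee ((N : ℤ) * b / l) := by
      rw [← ee_add]; congr 1; push_cast; field_simp
    rw [this]; ring
  rw [Finset.sum_congr rfl this, ← Finset.mul_sum, gs_twist h2]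
  ring

theorem hasSum_H3 {A : ℤ⟦X⟧} (hA : Conv (cc A)) {r : ℕ} (hr : r < 24) {L : ℕ} (hL : L ≠ 0) {τ : ℂ} (hτ : 0 < τ.im) :
    HasSum (fun N : ℕ => ((if L ∣ N then ta (A * PP ^ r) r (N / L) else 0 : ℤ) : ℂ) * ee (N * τ / 24)) (gg A r (L * τ)) := by
  have h1 := hasSum_gg hA hr (im_nat_mul hτ hL)
  have hinj : Function.Injective (fun n : ℕ => L * n) := fun a b h => Nat.eq_of_mul_eq_mul_left (Nat.pos_of_ne_zero hL) h
  rw [← hinj.hasSum_iff (fun n hn => by rw [if_neg (fun ⟨k, hk⟩ => hn ⟨k, hk.symm⟩)]; simp)]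
  refine Eq.mp (congrArg (fun f => HasSum f _) (funext fun n => ?_)) h1
  simp only [Function.comp, dvd_mul_right, if_true]
  rw [Nat.mul_div_cancel_left _ (Nat.pos_of_ne_zero hL)]
  congr 2; push_cast; ring

noncomputable def tt (l : ℕ) [Fact l.Prime] (K : ℤ) (e r : ℕ) (a : ℤ⟦X⟧) (N : ℕ) : ℤ :=
  ta a r (l ^ 2 * N) + K * legendreSym l N * ta a r N + l ^ e * (if l ^ 2 ∣ N then ta a r (N / l ^ 2) else 0)

theorem exists_K {r w : ℕ} (hr : Odd r) (hw : 2 ≤ w) (l : ℕ) [Fact l.Prime] (h2 : l ≠ 2) :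
    ∃ K : ℤ, (K : ℂ) = (1 / l ^ 2 * legendreSym l (-1) * (chi l * gs l) ^ r * l ^ w) * gs l := by
  have hl : l.Prime := Fact.out
  have hlC : (l : ℂ) ≠ 0 := by exact_mod_cast hl.ne_zero
  obtain ⟨s, rfl⟩ := hr
  obtain ⟨v, rfl⟩ := Nat.exists_eq_add_of_le hw
  refine ⟨legendreSym l (-1) * chi l ^ (2 * s + 1) * (legendreSym l (-1) * l) ^ (s + 1) * l ^ v, ?_⟩
  push_cast
  rw [← gs_sq h2]
  field_simp
  ring

theorem hasSum_GG {A : ℤ⟦X⟧} (hA : Conv (cc A)) {r w : ℕ} (hr : r < 24) (hw : 2 ≤ w) {l : ℕ} [Fact l.Prime] (h2 : l ≠ 2) {K : ℤ}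
    (hK : (K : ℂ) = (1 / l ^ 2 * legendreSym l (-1) * (chi l * gs l) ^ r * l ^ w) * gs l) {τ : ℂ} (hτ : 0 < τ.im) :
    HasSum (fun N : ℕ => (tt l K (r + 2 * w - 2) r (A * PP ^ r) N : ℂ) * ee (N * τ / 24)) (GG A r w l τ) := by
  have hl : l.Prime := Fact.out
  have hlC : (l : ℂ) ≠ 0 := by exact_mod_cast hl.ne_zero
  have hL0 : l ^ 2 ≠ 0 := pow_ne_zero 2 hl.ne_zero
  have h1 := hasSum_H1 hA hr hL0 hτ
  have h3 := (hasSum_H2 hA hr h2 hτ).mul_left (1 / l ^ 2 * legendreSym l (-1) * (chi l * gs l) ^ r * l ^ w : ℂ)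
  have h4 := (hasSum_H3 hA hr hL0 hτ).mul_left (1 / l ^ 2 * l ^ (r + 2 * w) : ℂ)
  have h5 := (h1.add h3).add h4
  have e : (1 / l ^ 2 * l ^ (r + 2 * w) : ℂ) = l ^ (r + 2 * w - 2) := by
    obtain ⟨v, hv⟩ := Nat.exists_eq_add_of_le (show 2 ≤ r + 2 * w by omega)
    rw [hv, Nat.add_sub_cancel_left, pow_add]; field_simp
  have h6 : GG A r w l τ = 1 / ((l ^ 2 : ℕ) : ℂ) * ∑ b ∈ range (l ^ 2), gg A r ((τ + 24 * b) / (l ^ 2 : ℕ)) +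
      (1 / l ^ 2 * legendreSym l (-1) * (chi l * gs l) ^ r * l ^ w) * ∑ b ∈ range l, legendreSym l b * gg A r (τ + 24 * b / l) +
      (1 / l ^ 2 * l ^ (r + 2 * w)) * gg A r ((l ^ 2 : ℕ) * τ) := by
    rw [GG]; push_cast; rfl
  rw [h6]
  refine Eq.mp (congrArg (fun f => HasSum f _) (funext fun N => ?_)) h5
  rw [tt, e]
  push_cast
  rw [hK]; ring

theorem tt_support {l : ℕ} [Fact l.Prime] (hL : l ^ 2 % 24 = 1) (K : ℤ) (e : ℕ) {r : ℕ} (a : ℤ⟦X⟧) (N : ℕ) (hN : N % 24 ≠ r) :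
    tt l K e r a N = 0 := by
  have h1 : l ^ 2 * N % 24 ≠ r := by rw [Nat.mul_mod, hL]; simpa using hN
  rw [tt, ta, if_neg h1, ta, if_neg hN]
  split_ifs with h
  · obtain ⟨n, rfl⟩ := h
    have hl : l.Prime := Fact.out
    rw [Nat.mul_div_cancel_left _ (pow_pos hl.pos 2), ta, if_neg]
    · simp
    · rw [Nat.mul_mod, hL] at hN; simpa using hN
  · simp

theorem hecke {w r l : ℕ} [Fact l.Prime] (h2 : l ≠ 2) (h3 : l ≠ 3) (hL : l ^ 2 % 24 = 1) (hw : Even w) (hw0 : 0 < w)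
    (hr : Odd r) (hr24 : r < 24) :
    ∃ K : ℤ, ∀ A : ℤ⟦X⟧, MF w A → ∃ B, MF w B ∧ ∀ N, ta (B * PP ^ r) r N = tt l K (r + 2 * w - 2) r (A * PP ^ r) N := by
  have hw2 : 2 ≤ w := by obtain ⟨v, rfl⟩ := hw; omega
  obtain ⟨K, hK⟩ := exists_K hr hw2 l h2
  obtain ⟨Q, hQ, hQc⟩ := exists_PP_inv
  refine ⟨K, fun A hA => ?_⟩
  let t : ℤ⟦X⟧ := PowerSeries.mk fun j => tt l K (r + 2 * w - 2) r (A * PP ^ r) (24 * j + r)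
  have hs : ∀ {τ : ℂ}, 0 < τ.im → HasSum (fun j => (cc t).coeff j * ee τ ^ j) (GG A r w l τ / ee (τ / 24) ^ r) := fun {τ} hτ => by
    have h := hasSum_GG hA.1 hr24 hw2 h2 hK hτ
    rw [hasSum_ta_iff hr24 _ (tt_support hL K _ _)] at h
    have h' := h.div_const (ee (τ / 24) ^ r)
    refine Eq.mp (congrArg (fun f => HasSum f _) (funext fun j => ?_)) h'
    rw [mul_div_cancel_left₀ _ (pow_ne_zero r (ee_ne_zero _)), coeff_map, coeff_mk]
    simp
  have hct : Conv (cc t) := Conv.of_H fun z hz => (hs hz).summable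
  have hEt : ∀ {τ : ℂ}, 0 < τ.im → GG A r w l τ = ee (τ / 24) ^ r * Ev (cc t) (ee τ) := fun {τ} hτ => by
    have h : Ev (cc t) (ee τ) = _ := (hs hτ).tsum_eq
    rw [h, mul_div_cancel₀ _ (pow_ne_zero r (ee_ne_zero _))]
  have hB : t * Q ^ r * PP ^ r = t := by
    rw [mul_assoc, ← mul_pow, mul_comm Q, hQ, one_pow, mul_one]
  have hBc : Conv (cc (t * Q ^ r)) := by rw [map_mul, map_pow]; exact hct.mul (hQc.pow r)
  have hG : ∀ {τ : ℂ}, 0 < τ.im → GG A r w l τ = et τ ^ r * Ev (cc (t * Q ^ r)) (ee τ) := fun {τ} hτ => by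
    have := gg_eq hBc r hτ
    rw [hB, ← hEt hτ, gg] at this
    exact this.symm
  refine ⟨t * Q ^ r, ⟨hBc, fun z hz => ?_⟩, fun N => ?_⟩
  · have h := GG_S hw hA hr h2 h3 (by omega) hz
    rw [hG hz, hG (im_S hz), et_S hz, JJ] at h
    have h0 : (ss z * et z) ^ r ≠ 0 := by
      rw [← et_S hz]; exact pow_ne_zero r (et_ne_zero (im_S hz))
    apply mul_left_cancel₀ h0
    rw [h]; ring
  · rw [hB]
    by_cases hN : N % 24 = r
    · rw [ta, if_pos hN, coeff_mk]; congr 1; omega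
    · rw [tt_support hL _ _ _ _ hN, ta, if_neg hN]

def SS (w : ℕ) : AddSubgroup ℤ⟦X⟧ where
  carrier := {A | MF w A}
  add_mem' := fun ha hb => MF.add ha hb
  zero_mem' := MF.zero w
  neg_mem' := fun {x} hx => by
    have := MF.sub (MF.zero w) hx
    rwa [zero_sub] at this

theorem SS_finite (w : ℕ) : Module.Finite ℤ (SS w) := by
  let φ : SS w →+ (Fin (w / 12 + 1) → ℤ) :=
    { toFun := fun A n => (A : ℤ⟦X⟧).coeff n
      map_zero' := by funext n; simp
      map_add' := fun A B => by funext n; simp }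
  have hφ : Function.Injective φ := by
    rw [injective_iff_map_eq_zero]
    intro A hA
    apply Subtype.ext
    refine MF.sturm A.2 fun n hn => ?_
    exact congrFun hA ⟨n, by omega⟩
  exact Module.Finite.of_injective φ.toIntLinearMap hφ

theorem hom_finite (w q : ℕ) [NeZero q] : Finite (SS w →+ ZMod q) := by
  have := SS_finite w
  obtain ⟨s, hs⟩ := (Module.Finite.fg_top : (⊤ : Submodule ℤ (SS w)).FG)
  refine Finite.of_injective (fun φ : SS w →+ ZMod q => fun x : s => φ x) fun φ ψ h => ?_
  have h1 : φ.toIntLinearMap = ψ.toIntLinearMap := by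
    refine LinearMap.ext_on hs fun x hx => ?_
    exact congrFun h ⟨x, hx⟩
  ext x
  exact LinearMap.congr_fun h1 x

theorem ta_add (a b : ℤ⟦X⟧) (r N : ℕ) : ta (a + b) r N = ta a r N + ta b r N := by
  rw [ta, ta, ta]; split_ifs <;> simp

theorem ta_ext {a b : ℤ⟦X⟧} {r : ℕ} (hr : r < 24) (h : ∀ N, ta a r N = ta b r N) : a = b := by
  ext j
  have := h (24 * j + r)
  rwa [ta, ta, if_pos (by omega), if_pos (by omega), show (24 * j + r) / 24 = j by omega] at this

theorem tt_add (l : ℕ) [Fact l.Prime] (K : ℤ) (e r : ℕ) (a b : ℤ⟦X⟧) (N : ℕ) :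
    tt l K e r (a + b) N = tt l K e r a N + tt l K e r b N := by
  rw [tt, tt, tt, ta_add, ta_add, ta_add]; split_ifs <;> ring

theorem exists_T {w r l : ℕ} [Fact l.Prime] (h2 : l ≠ 2) (h3 : l ≠ 3) (hL : l ^ 2 % 24 = 1) (hw : Even w) (hw0 : 0 < w)
    (hr : Odd r) (hr24 : r < 24) :
    ∃ (K : ℤ) (T : SS w →+ SS w), ∀ A N, ta ((T A : ℤ⟦X⟧) * PP ^ r) r N = tt l K (r + 2 * w - 2) r ((A : ℤ⟦X⟧) * PP ^ r) N := by
  obtain ⟨K, hK⟩ := hecke h2 h3 hL hw hw0 hr hr24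
  choose B hB ht using hK
  have hP : PP ^ r ≠ 0 := pow_ne_zero r (fun h => by have := PP_coeff_zero; rw [h] at this; simp at this)
  refine ⟨K, AddMonoidHom.mk' (fun A => ⟨B A A.2, hB A A.2⟩) (fun A A' => ?_), fun A N => ht A A.2 N⟩
  apply Subtype.ext
  apply mul_right_cancel₀ hP
  refine ta_ext hr24 fun N => ?_
  have h : ta ((B A A.2 + B A' A'.2) * PP ^ r) r N = tt l K (r + 2 * w - 2) r (((A + A' : SS w) : ℤ⟦X⟧) * PP ^ r) N := by
    rw [add_mul, ta_add]
    refine (congrArg₂ (· + ·) (ht _ _ N) (ht _ _ N)).trans ?_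
    rw [← tt_add, ← add_mul]
    rfl
  exact (ht _ _ N).trans h.symm

theorem periodic {w r l q : ℕ} [Fact l.Prime] [NeZero q] (hlq : Nat.Coprime l q) (h2 : l ≠ 2) (h3 : l ≠ 3) (hL : l ^ 2 % 24 = 1)
    (hw : Even w) (hw0 : 0 < w) (hr : Odd r) (hr24 : r < 24) :
    ∃ M : ℕ, 0 < M ∧ ∀ A, MF w A → ∀ N,
      (ta (A * PP ^ r) r N : ZMod q) = (ta (A * PP ^ r) r ((l ^ 2) ^ M * N) : ZMod q) := by
  have hl : l.Prime := Fact.out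
  obtain ⟨K, T, hT⟩ := exists_T h2 h3 hL hw hw0 hr hr24
  have := hom_finite w q
  let v : ℕ → (SS w →+ ZMod q) := fun N => AddMonoidHom.mk' (fun A => (ta ((A : ℤ⟦X⟧) * PP ^ r) r N : ZMod q)) (fun A B => by
    rw [AddSubgroup.coe_add, add_mul, ta_add, Int.cast_add])
  let Ψ : (SS w →+ ZMod q) × (SS w →+ ZMod q) → (SS w →+ ZMod q) × (SS w →+ ZMod q) :=
    fun p => (p.2, p.2.comp T - (l ^ (r + 2 * w - 2)) • p.1)
  have hinj : Function.Injective Ψ := by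
    rintro ⟨u, x⟩ ⟨u', x'⟩ h
    simp only [Ψ, Prod.mk.injEq] at h
    obtain ⟨rfl, h⟩ := h
    have h1 := sub_right_injective h
    congr 1
    ext A
    have h4 := DFunLike.congr_fun h1 A
    simp only [AddMonoidHom.nsmul_apply, nsmul_eq_mul] at h4
    have hu : IsUnit ((l ^ (r + 2 * w - 2) : ℕ) : ZMod q) := (ZMod.isUnit_iff_coprime _ _).mpr (hlq.pow_left _)
    exact hu.mul_left_cancel h4
  let e := Equiv.ofBijective Ψ (Finite.injective_iff_bijective.mp hinj)
  refine ⟨orderOf e, orderOf_pos e, fun A hA N => ?_⟩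
  have hstep : ∀ j, Ψ (v ((l ^ 2) ^ j * N), v ((l ^ 2) ^ (j + 1) * N)) = (v ((l ^ 2) ^ (j + 1) * N), v ((l ^ 2) ^ (j + 2) * N)) := fun j => by
    simp only [Ψ, Prod.mk.injEq, true_and]
    ext B
    simp only [v, AddMonoidHom.sub_apply, AddMonoidHom.nsmul_apply, AddMonoidHom.comp_apply, AddMonoidHom.mk'_apply, nsmul_eq_mul]
    rw [hT, tt]
    have e1 : (l ^ 2) ^ (j + 1) * N = l ^ 2 * ((l ^ 2) ^ j * N) := by ring
    have hleg : legendreSym l (((l ^ 2) ^ (j + 1) * N : ℕ) : ℤ) = 0 := by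
      rw [legendreSym.eq_zero_iff, ZMod.intCast_zmod_eq_zero_iff_dvd]
      exact_mod_cast (⟨l * ((l ^ 2) ^ j * N), by rw [e1]; ring⟩ : l ∣ (l ^ 2) ^ (j + 1) * N)
    rw [hleg, if_pos ⟨_, e1⟩]
    rw [show (l ^ 2) ^ (j + 1) * N / l ^ 2 = (l ^ 2) ^ j * N by rw [e1, Nat.mul_div_cancel_left _ (pow_pos hl.pos 2)]]
    rw [show l ^ 2 * ((l ^ 2) ^ (j + 1) * N) = (l ^ 2) ^ (j + 2) * N by ring]
    push_cast; ring
  have hiter : ∀ j, Ψ^[j] (v N, v (l ^ 2 * N)) = (v ((l ^ 2) ^ j * N), v ((l ^ 2) ^ (j + 1) * N)) := fun j => by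
    induction j with
    | zero => simp
    | succ j ih => rw [Function.iterate_succ_apply', ih, hstep]
  have h1 : Ψ^[orderOf e] (v N, v (l ^ 2 * N)) = (v N, v (l ^ 2 * N)) := by
    have h : (e : _ → _)^[orderOf e] = ((e ^ orderOf e : Equiv.Perm _) : _ → _) := Equiv.Perm.iterate_eq_pow e _
    rw [pow_orderOf_eq_one] at h
    exact congrFun h _
  rw [hiter] at h1
  exact (DFunLike.congr_fun (Prod.mk.inj h1).1 (⟨A, hA⟩ : SS w)).symm

theorem sq_mod24 {l : ℕ} (hl : l.Prime) (h2 : l ≠ 2) (h3 : l ≠ 3) : l ^ 2 % 24 = 1 := by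
  have e2 : l % 2 ≠ 0 := fun h => h2 ((Nat.prime_dvd_prime_iff_eq Nat.prime_two hl).mp (Nat.dvd_of_mod_eq_zero h)).symm
  have e3 : l % 3 ≠ 0 := fun h => h3 ((Nat.prime_dvd_prime_iff_eq Nat.prime_three hl).mp (Nat.dvd_of_mod_eq_zero h)).symm
  have h : ∀ x < 24, x % 2 ≠ 0 → x % 3 ≠ 0 → x ^ 2 % 24 = 1 := by decide
  rw [Nat.pow_mod]
  exact h _ (Nat.mod_lt _ (by norm_num)) (by omega) (by omega)

end

theorem multipartition_prime_power_periodicity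
    (m k r ℓ : ℕ) (hm : m.Prime) (hm5 : 5 ≤ m) (hk : 0 < k)
    (hr : 0 < r) (hrodd : Odd r) (hrm : r < m ^ k)
    (hl : ℓ.Prime) (hl2 : ℓ ≠ 2) (hl3 : ℓ ≠ 3) (hlm : ℓ ≠ m) :
    ∃ M : ℕ, 0 < M ∧ ∀ i n : ℕ,
      24 ∣ m ^ k * ℓ ^ i * n + r →
      multipartition r ((m ^ k * ℓ ^ i * n + r) / 24) ≡
        multipartition r ((m ^ k * ℓ ^ (2 * M + i) * n + r) / 24) [MOD m ^ k] := by
  have : Fact ℓ.Prime := ⟨hl⟩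
  have : NeZero (m ^ k) := ⟨pow_ne_zero k hm.ne_zero⟩
  have hL := sq_mod24 hl hl2 hl3
  obtain ⟨w, r', f, hw0, hw, hr', hr24, hf, hd, hcoe⟩ := exists_main m k r hm hm5 hk hr hrodd hrm
  obtain ⟨M, hM, hper⟩ := periodic (q := m ^ k) (((Nat.coprime_primes hl hm).mpr hlm).pow_right k) hl2 hl3 hL hw hw0 hr' hr24
  refine ⟨M, hM, fun i n h24 => ?_⟩
  have hcop : Nat.Coprime 24 (m ^ k) := by
    apply Nat.Coprime.pow_right
    have e2 : Nat.Coprime 2 m := (Nat.coprime_primes Nat.prime_two hm).mpr (by omega)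
    have e3 : Nat.Coprime 3 m := (Nat.coprime_primes Nat.prime_three hm).mpr (by omega)
    have := (e2.pow_left 3).mul_left e3
    norm_num at this
    exact this
  have key : ∀ N, N % 24 = r' → (ta (f * PP ^ r') r' N : ZMod (m ^ k)) = multipartition r ((m ^ k * N + r) / 24) := fun N hN => by
    have h1 := hcoe (N / 24)
    rw [show 24 * (N / 24) + r' = N by omega] at h1
    rw [ta, if_pos hN]
    have h3 := (ZMod.intCast_zmod_eq_zero_iff_dvd _ _).mpr h1
    rw [Int.cast_sub, sub_eq_zero] at h3
    rw [h3]; simp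
  have hN : (ℓ ^ i * n) % 24 = r' := by
    have h1 : m ^ k * (ℓ ^ i * n) + r ≡ m ^ k * r' + r [MOD 24] :=
      ((Nat.modEq_zero_iff_dvd.mpr (by rwa [← mul_assoc])).trans (Nat.modEq_zero_iff_dvd.mpr hd).symm)
    have h3 := Nat.ModEq.cancel_left_of_coprime hcop (Nat.ModEq.add_right_cancel' r h1)
    have h4 : (ℓ ^ i * n) % 24 = r' % 24 := h3
    rw [h4]; exact Nat.mod_eq_of_lt hr24
  have hN2 : ((ℓ ^ 2) ^ M * (ℓ ^ i * n)) % 24 = r' := by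
    rw [Nat.mul_mod, Nat.pow_mod, hL, one_pow, hN]
    omega
  have h1 := hper f hf (ℓ ^ i * n)
  rw [key _ hN, key _ hN2, ZMod.natCast_eq_natCast_iff] at h1
  rw [mul_assoc, mul_assoc, show ℓ ^ (2 * M + i) * n = (ℓ ^ 2) ^ M * (ℓ ^ i * n) by rw [← pow_mul, pow_add]; ring]
  exact h1
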